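/- Let (3,c,m) be an e-admissible triplet. (i) If c = 3, then α(3,3,m) = β(3,3,m) = 3/4. (ii) If c ≥ 4 and m = c+1, then α(3,c,c+1) = β(3,c,c+1) = c/4. (iii) If c ≥ 4 and m = c+u for an integer u with 2 ≤ u < ⌊(c-2)/2⌋, then 1 ≤ α(3,c,c+u) ≤ 5/4 + (1/4)·⌈(c-2)/u⌉. (iv) If c ≥ 4 and c + ⌊(c-2)/2⌋ ≤ m < c(c-1)/2, then 1 ≤ α(3,c,m) ≤ 3/2. (v) If c ≥ 4 and m ≥ c(c-1)/2, then α(3,c,m) = 1. -/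

import Mathlib

open SimpleGraph Set

/-- Auxiliary distance on representations of points of the metric graph:
a point is represented by `(u, v, t)` with `u, v` adjacent and `t ∈ [0,1]`,
meaning the point on the edge `[u,v]` at distance `t` from `u`. -/
noncomputable def mgDistAux {V : Type} [Fintype V] [DecidableEq V] (G : SimpleGraph V)
    (p q : V × V × ℝ) : ℝ :=
  min
    (min (if p.1 = q.1 ∧ p.2.1 = q.2.1 then |p.2.2 - q.2.2| else (Fintype.card V : ℝ) + 1)
         (if p.1 = q.2.1 ∧ p.2.1 = q.1 then |p.2.2 - (1 - q.2.2)| else (Fintype.card V : ℝ) + 1))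
    (min (min (p.2.2 + (G.dist p.1 q.1 : ℝ) + q.2.2)
              (p.2.2 + (G.dist p.1 q.2.1 : ℝ) + (1 - q.2.2)))
         (min ((1 - p.2.2) + (G.dist p.2.1 q.1 : ℝ) + q.2.2)
              ((1 - p.2.2) + (G.dist p.2.1 q.2.1 : ℝ) + (1 - q.2.2))))

/-- The points of the metric graph associated to a simple graph `G`:
the vertices together with the interior points of the edges. -/
def MGPoint {V : Type} (G : SimpleGraph V) : Type :=
  {p : V × V × ℝ // G.Adj p.1 p.2.1 ∧ p.2.2 ∈ Set.Icc (0 : ℝ) 1}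

/-- The shortest-path distance on the metric graph associated to `G`
(every edge has length 1). -/
noncomputable def mgDist {V : Type} [Fintype V] [DecidableEq V] (G : SimpleGraph V)
    (p q : MGPoint G) : ℝ := mgDistAux G p.1 q.1

/-- Distance from a vertex `v` to a point of the metric graph. -/
noncomputable def mgVDist {V : Type} [Fintype V] [DecidableEq V] (G : SimpleGraph V)
    (v : V) (x : MGPoint G) : ℝ :=
  min ((G.dist v x.1.1 : ℝ) + x.1.2.2) ((G.dist v x.1.2.1 : ℝ) + (1 - x.1.2.2))

/-- `γ` restricted to `[a,b]` is a geodesic in the metric graph of `G`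
(an arc-length parametrization realizing distances). -/
def IsMGGeodesic {V : Type} [Fintype V] [DecidableEq V] (G : SimpleGraph V)
    (a b : ℝ) (γ : ℝ → MGPoint G) : Prop :=
  a ≤ b ∧ ∀ s ∈ Set.Icc a b, ∀ t ∈ Set.Icc a b, mgDist G (γ s) (γ t) = |s - t|

/-- A geodesic triangle in the metric graph of `G`: three geodesic sides whose
endpoints match cyclically (distance `0` means equality of points). -/
structure MGTriangle {V : Type} [Fintype V] [DecidableEq V] (G : SimpleGraph V) where
  a1 : ℝ
  b1 : ℝ
  a2 : ℝ
  b2 : ℝ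
  a3 : ℝ
  b3 : ℝ
  g1 : ℝ → MGPoint G
  g2 : ℝ → MGPoint G
  g3 : ℝ → MGPoint G
  h1 : IsMGGeodesic G a1 b1 g1
  h2 : IsMGGeodesic G a2 b2 g2
  h3 : IsMGGeodesic G a3 b3 g3
  glue1 : mgDist G (g1 b1) (g2 a2) = 0
  glue2 : mgDist G (g2 b2) (g3 a3) = 0
  glue3 : mgDist G (g3 b3) (g1 a1) = 0

/-- The sharp thin constant `δ(T)` of a geodesic triangle: the infimum of the
`d ≥ 0` such that each side is contained in the `d`-neighborhood of the union of
the other two sides. -/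
noncomputable def triangleDelta {V : Type} [Fintype V] [DecidableEq V] {G : SimpleGraph V}
    (T : MGTriangle G) : ℝ :=
  sInf {d : ℝ | 0 ≤ d ∧
    (∀ s ∈ Set.Icc T.a1 T.b1,
      (∃ t ∈ Set.Icc T.a2 T.b2, mgDist G (T.g1 s) (T.g2 t) ≤ d) ∨
      (∃ t ∈ Set.Icc T.a3 T.b3, mgDist G (T.g1 s) (T.g3 t) ≤ d)) ∧
    (∀ s ∈ Set.Icc T.a2 T.b2,
      (∃ t ∈ Set.Icc T.a1 T.b1, mgDist G (T.g2 s) (T.g1 t) ≤ d) ∨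
      (∃ t ∈ Set.Icc T.a3 T.b3, mgDist G (T.g2 s) (T.g3 t) ≤ d)) ∧
    (∀ s ∈ Set.Icc T.a3 T.b3,
      (∃ t ∈ Set.Icc T.a1 T.b1, mgDist G (T.g3 s) (T.g1 t) ≤ d) ∨
      (∃ t ∈ Set.Icc T.a2 T.b2, mgDist G (T.g3 s) (T.g2 t) ≤ d))}

/-- The hyperbolicity constant `δ(G)`: the supremum of `δ(T)` over all geodesic
triangles `T` in the metric graph of `G`. -/
noncomputable def hypDelta {V : Type} [Fintype V] [DecidableEq V] (G : SimpleGraph V) : ℝ :=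
  sSup {d : ℝ | ∃ T : MGTriangle G, d = triangleDelta T}

/-- The circumference of `G`: the length of a longest cycle. -/
noncomputable def circumference {V : Type} (G : SimpleGraph V) : ℕ :=
  sSup {n : ℕ | ∃ (a : V) (w : G.Walk a a), w.IsCycle ∧ w.length = n}

/-- `G` belongs to the class `𝒢(g,c,n)` of (connected) graphs with girth `g`,
circumference `c` and `n` vertices (vertex set `Fin n`). -/
def memGclass (g c : ℕ) {n : ℕ} (G : SimpleGraph (Fin n)) : Prop :=
  G.Connected ∧ G.girth = g ∧ circumference G = c

/-- `A(g,c,n) = min {δ(G) : G ∈ 𝒢(g,c,n)}`. -/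
noncomputable def Agcn (g c n : ℕ) : ℝ :=
  sInf {d : ℝ | ∃ G : SimpleGraph (Fin n), memGclass g c G ∧ d = hypDelta G}

/-- `B(g,c,n) = max {δ(G) : G ∈ 𝒢(g,c,n)}`. -/
noncomputable def Bgcn (g c n : ℕ) : ℝ :=
  sSup {d : ℝ | ∃ G : SimpleGraph (Fin n), memGclass g c G ∧ d = hypDelta G}

/-- `G` belongs to the class `ℋ(g,c,m)` of (connected) graphs with girth `g`,
circumference `c` and `m` edges. -/
def memHclass (g c m : ℕ) {k : ℕ} (G : SimpleGraph (Fin k)) : Prop :=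
  G.Connected ∧ G.girth = g ∧ circumference G = c ∧ G.edgeSet.ncard = m

/-- `α(g,c,m) = min {δ(G) : G ∈ ℋ(g,c,m)}`. -/
noncomputable def alphagcm (g c m : ℕ) : ℝ :=
  sInf {d : ℝ | ∃ (k : ℕ) (G : SimpleGraph (Fin k)), memHclass g c m G ∧ d = hypDelta G}

/-- `β(g,c,m) = max {δ(G) : G ∈ ℋ(g,c,m)}`. -/
noncomputable def betagcm (g c m : ℕ) : ℝ :=
  sSup {d : ℝ | ∃ (k : ℕ) (G : SimpleGraph (Fin k)), memHclass g c m G ∧ d = hypDelta G}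

open SimpleGraph Set

set_option linter.unusedSectionVars false

namespace MGH

lemma abs_aux1 (a b : ℝ) : |a - (1 - b)| = |b - (1 - a)| := by
  rw [show a - (1 - b) = b - (1 - a) by ring]

lemma abs_aux2 (x y z : ℝ) : |x - (1 - z)| ≤ |x - (1 - y)| + |y - z| := by
  rw [show x - (1 - z) = (x - (1 - y)) - (y - z) by ring]; exact abs_sub _ _

lemma abs_aux3 (x y z : ℝ) : |x - z| ≤ |x - (1 - y)| + |y - (1 - z)| := by
  rw [show x - z = (x - (1 - y)) - (y - (1 - z)) by ring]; exact abs_sub _ _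

/-- `e` is an end of the edge carrying `x`, at distance `s` from `x` along that edge. -/
def IsEnd {V : Type} {G : SimpleGraph V} (x : MGPoint G) (e : V) (s : ℝ) : Prop :=
  (e = x.1.1 ∧ s = x.1.2.2) ∨ (e = x.1.2.1 ∧ s = 1 - x.1.2.2)

/-- `x`, `y` lie on a common edge, at distance `r` along that edge. -/
def IsLoc {V : Type} {G : SimpleGraph V} (x y : MGPoint G) (r : ℝ) : Prop :=
  (x.1.1 = y.1.1 ∧ x.1.2.1 = y.1.2.1 ∧ r = |x.1.2.2 - y.1.2.2|) ∨
  (x.1.1 = y.1.2.1 ∧ x.1.2.1 = y.1.1 ∧ r = |x.1.2.2 - (1 - y.1.2.2)|)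

section basics

variable {V : Type} [Fintype V] [DecidableEq V] {G : SimpleGraph V}

lemma IsEnd.nonneg {x : MGPoint G} {e : V} {s : ℝ} (h : IsEnd x e s) : 0 ≤ s ∧ s ≤ 1 := by
  have := x.2.2
  simp only [Set.mem_Icc] at this
  rcases h with ⟨_, rfl⟩ | ⟨_, rfl⟩ <;> constructor <;> linarith

lemma isEnd_left (x : MGPoint G) : IsEnd x x.1.1 x.1.2.2 := Or.inl ⟨rfl, rfl⟩
lemma isEnd_right (x : MGPoint G) : IsEnd x x.1.2.1 (1 - x.1.2.2) := Or.inr ⟨rfl, rfl⟩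

/-- The other end of the edge. -/
lemma IsEnd.other {x : MGPoint G} {e : V} {s : ℝ} (h : IsEnd x e s) :
    ∃ e', G.Adj e e' ∧ IsEnd x e' (1 - s) ∧ ∀ f t, IsEnd x f t → (f = e ∧ t = s) ∨
      (f = e' ∧ t = 1 - s) := by
  have ha := x.2.1
  rcases h with ⟨rfl, rfl⟩ | ⟨rfl, rfl⟩
  · exact ⟨_, ha, isEnd_right x, fun f t h => h⟩
  · refine ⟨_, ha.symm, Or.inl ⟨rfl, by ring⟩, fun f t h => ?_⟩
    rcases h with h | h
    · right; exact ⟨h.1, by rw [h.2]; ring⟩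
    · left; exact h

lemma dist_tri (hG : G.Connected) (a b c : V) :
    (G.dist a c : ℝ) ≤ G.dist a b + G.dist b c := by
  exact_mod_cast hG.dist_triangle

lemma dist_adj {a b : V} (h : G.Adj a b) : (G.dist a b : ℝ) = 1 := by
  exact_mod_cast dist_eq_one_iff_adj.2 h

lemma dist_comm' (a b : V) : (G.dist a b : ℝ) = G.dist b a := by
  rw [SimpleGraph.dist_comm]

lemma dist_lt_card (hG : G.Connected) (a b : V) : (G.dist a b : ℝ) + 1 ≤ Fintype.card V := by
  obtain ⟨p, hp, hl⟩ := hG.exists_path_of_dist a b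
  have := hp.length_lt
  rw [← hl]; exact_mod_cast this

lemma mgVDist_le {x : MGPoint G} {e : V} {s : ℝ} (h : IsEnd x e s) (v : V) :
    mgVDist G v x ≤ G.dist v e + s := by
  unfold mgVDist
  rcases h with ⟨rfl, rfl⟩ | ⟨rfl, rfl⟩
  · exact min_le_left _ _
  · exact min_le_right _ _

lemma mgVDist_cases (v : V) (x : MGPoint G) :
    ∃ e s, IsEnd x e s ∧ mgVDist G v x = G.dist v e + s := by
  unfold mgVDist
  rcases min_choice ((G.dist v x.1.1 : ℝ) + x.1.2.2) ((G.dist v x.1.2.1 : ℝ) + (1 - x.1.2.2))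
    with h | h
  · exact ⟨_, _, isEnd_left x, h⟩
  · exact ⟨_, _, isEnd_right x, h⟩

lemma mgDist_le_ends {x y : MGPoint G} {e f : V} {s t : ℝ} (hx : IsEnd x e s) (hy : IsEnd y f t) :
    mgDist G x y ≤ s + G.dist e f + t := by
  unfold mgDist mgDistAux
  rcases hx with ⟨rfl, rfl⟩ | ⟨rfl, rfl⟩ <;> rcases hy with ⟨rfl, rfl⟩ | ⟨rfl, rfl⟩ <;> simp

lemma mgDist_le_loc {x y : MGPoint G} {r : ℝ} (h : IsLoc x y r) : mgDist G x y ≤ r := by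
  unfold mgDist mgDistAux
  rcases h with ⟨h1, h2, rfl⟩ | ⟨h1, h2, rfl⟩
  · refine le_trans (min_le_left _ _) (le_trans (min_le_left _ _) ?_)
    rw [if_pos ⟨h1, h2⟩]
  · refine le_trans (min_le_left _ _) (le_trans (min_le_right _ _) ?_)
    rw [if_pos ⟨h1, h2⟩]

lemma mgDist_cases (hG : G.Connected) (x y : MGPoint G) :
    IsLoc x y (mgDist G x y) ∨
    ∃ e s f t, IsEnd x e s ∧ IsEnd y f t ∧ mgDist G x y = s + G.dist e f + t := by
  have hx := x.2.2
  have hy := y.2.2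
  simp only [Set.mem_Icc] at hx hy
  have h1 := mgDist_le_ends (isEnd_left x) (isEnd_left y)
  have h2 := mgDist_le_ends (isEnd_right x) (isEnd_right y)
  have c1 := dist_lt_card hG x.1.1 y.1.1
  have c2 := dist_lt_card hG x.1.2.1 y.1.2.1
  have hne : mgDist G x y ≠ Fintype.card V + 1 := by
    intro h; linarith
  have key : mgDist G x y = mgDistAux G x.1 y.1 := rfl
  unfold mgDistAux at key
  rcases min_choice (min (if x.1.1 = y.1.1 ∧ x.1.2.1 = y.1.2.1 then |x.1.2.2 - y.1.2.2| else (Fintype.card V : ℝ) + 1)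
         (if x.1.1 = y.1.2.1 ∧ x.1.2.1 = y.1.1 then |x.1.2.2 - (1 - y.1.2.2)| else (Fintype.card V : ℝ) + 1)) (min (min (x.1.2.2 + (G.dist x.1.1 y.1.1 : ℝ) + y.1.2.2)
              (x.1.2.2 + (G.dist x.1.1 y.1.2.1 : ℝ) + (1 - y.1.2.2)))
         (min ((1 - x.1.2.2) + (G.dist x.1.2.1 y.1.1 : ℝ) + y.1.2.2)
              ((1 - x.1.2.2) + (G.dist x.1.2.1 y.1.2.1 : ℝ) + (1 - y.1.2.2)))) with h | h
  · left
    rw [h] at key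
    rcases min_choice (if x.1.1 = y.1.1 ∧ x.1.2.1 = y.1.2.1 then |x.1.2.2 - y.1.2.2| else (Fintype.card V : ℝ) + 1)
         (if x.1.1 = y.1.2.1 ∧ x.1.2.1 = y.1.1 then |x.1.2.2 - (1 - y.1.2.2)| else (Fintype.card V : ℝ) + 1) with h' | h'
    · rw [h'] at key
      split_ifs at key with hc
      · exact Or.inl ⟨hc.1, hc.2, key⟩
      · exact absurd key hne
    · rw [h'] at key
      split_ifs at key with hc
      · exact Or.inr ⟨hc.1, hc.2, key⟩
      · exact absurd key hne
  · right
    rw [h] at key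
    rcases min_choice (min (x.1.2.2 + (G.dist x.1.1 y.1.1 : ℝ) + y.1.2.2)
              (x.1.2.2 + (G.dist x.1.1 y.1.2.1 : ℝ) + (1 - y.1.2.2)))
         (min ((1 - x.1.2.2) + (G.dist x.1.2.1 y.1.1 : ℝ) + y.1.2.2)
              ((1 - x.1.2.2) + (G.dist x.1.2.1 y.1.2.1 : ℝ) + (1 - y.1.2.2))) with h' | h' <;>
      rw [h'] at key
    · rcases min_choice (x.1.2.2 + (G.dist x.1.1 y.1.1 : ℝ) + y.1.2.2)
              (x.1.2.2 + (G.dist x.1.1 y.1.2.1 : ℝ) + (1 - y.1.2.2)) with h'' | h'' <;>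
        rw [h''] at key
      · exact ⟨_, _, _, _, isEnd_left x, isEnd_left y, key⟩
      · exact ⟨_, _, _, _, isEnd_left x, isEnd_right y, key⟩
    · rcases min_choice ((1 - x.1.2.2) + (G.dist x.1.2.1 y.1.1 : ℝ) + y.1.2.2)
              ((1 - x.1.2.2) + (G.dist x.1.2.1 y.1.2.1 : ℝ) + (1 - y.1.2.2)) with h'' | h'' <;>
        rw [h''] at key
      · exact ⟨_, _, _, _, isEnd_right x, isEnd_left y, key⟩
      · exact ⟨_, _, _, _, isEnd_right x, isEnd_right y, key⟩

lemma isLoc_symm {x y : MGPoint G} {r : ℝ} (h : IsLoc x y r) : IsLoc y x r := by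
  rcases h with ⟨h1, h2, rfl⟩ | ⟨h1, h2, rfl⟩
  · exact Or.inl ⟨h1.symm, h2.symm, abs_sub_comm _ _⟩
  · refine Or.inr ⟨h2.symm, h1.symm, ?_⟩
    exact abs_aux1 _ _

lemma isLoc_nonneg {x y : MGPoint G} {r : ℝ} (h : IsLoc x y r) : 0 ≤ r := by
  rcases h with ⟨h1, h2, rfl⟩ | ⟨h1, h2, rfl⟩ <;> exact abs_nonneg _

lemma mgDist_nonneg (hG : G.Connected) (x y : MGPoint G) : 0 ≤ mgDist G x y := by
  rcases mgDist_cases hG x y with h | ⟨e, s, f, t, h1, h2, h⟩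
  · exact isLoc_nonneg h
  · have := h1.nonneg; have := h2.nonneg; have : (0:ℝ) ≤ G.dist e f := Nat.cast_nonneg _; linarith

lemma mgDist_le_symm (hG : G.Connected) (x y : MGPoint G) : mgDist G x y ≤ mgDist G y x := by
  rcases mgDist_cases hG y x with h | ⟨e, s, f, t, h1, h2, h⟩
  · exact mgDist_le_loc (isLoc_symm h)
  · have := mgDist_le_ends h2 h1
    rw [h, dist_comm' e f]; linarith

lemma mgDist_comm (hG : G.Connected) (x y : MGPoint G) : mgDist G x y = mgDist G y x :=
  le_antisymm (mgDist_le_symm hG x y) (mgDist_le_symm hG y x)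

lemma mgDist_self (hG : G.Connected) (x : MGPoint G) : mgDist G x x = 0 := by
  apply le_antisymm _ (mgDist_nonneg hG x x)
  exact mgDist_le_loc (Or.inl ⟨rfl, rfl, by simp⟩)

/-- An end transfers along a local distance. -/
lemma IsLoc.end_transfer {x y : MGPoint G} {r : ℝ} (h : IsLoc x y r) {e : V} {t : ℝ}
    (hy : IsEnd y e t) : ∃ s, IsEnd x e s ∧ s ≤ t + r ∧ t ≤ s + r := by
  rcases h with ⟨h1, h2, rfl⟩ | ⟨h1, h2, rfl⟩
  · rcases hy with ⟨rfl, rfl⟩ | ⟨rfl, rfl⟩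
    · refine ⟨_, Or.inl ⟨h1.symm, rfl⟩, ?_, ?_⟩ <;> rcases abs_cases (x.1.2.2 - y.1.2.2) with h | h <;> linarith
    · refine ⟨_, Or.inr ⟨h2.symm, rfl⟩, ?_, ?_⟩ <;> rcases abs_cases (x.1.2.2 - y.1.2.2) with h | h <;> linarith
  · rcases hy with ⟨rfl, rfl⟩ | ⟨rfl, rfl⟩
    · refine ⟨_, Or.inr ⟨h2.symm, rfl⟩, ?_, ?_⟩ <;> rcases abs_cases (x.1.2.2 - (1 - y.1.2.2)) with h | h <;> linarith
    · refine ⟨_, Or.inl ⟨h1.symm, rfl⟩, ?_, ?_⟩ <;> rcases abs_cases (x.1.2.2 - (1 - y.1.2.2)) with h | h <;> linarith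

lemma IsLoc.trans {x y z : MGPoint G} {r s : ℝ} (h : IsLoc x y r) (h' : IsLoc y z s) :
    ∃ q, IsLoc x z q ∧ q ≤ r + s := by
  rcases h with ⟨h1, h2, rfl⟩ | ⟨h1, h2, rfl⟩ <;> rcases h' with ⟨h3, h4, rfl⟩ | ⟨h3, h4, rfl⟩
  · refine ⟨_, Or.inl ⟨h1.trans h3, h2.trans h4, rfl⟩, abs_sub_le _ _ _⟩
  · refine ⟨_, Or.inr ⟨h1.trans h3, h2.trans h4, rfl⟩, abs_sub_le _ _ _⟩
  · refine ⟨_, Or.inr ⟨h1.trans h4, h2.trans h3, rfl⟩, ?_⟩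
    exact abs_aux2 _ _ _
  · refine ⟨_, Or.inl ⟨h1.trans h4, h2.trans h3, rfl⟩, ?_⟩
    exact abs_aux3 _ _ _

/-- Distance of two ends of the same point. -/
lemma dist_ends (x : MGPoint G) {e f : V} {s t : ℝ} (h1 : IsEnd x e s) (h2 : IsEnd x f t) :
    (G.dist e f : ℝ) ≤ s + t := by
  have ha := dist_adj x.2.1
  have hx := x.2.2
  simp only [Set.mem_Icc] at hx
  have h0 : ∀ v : V, (G.dist v v : ℝ) = 0 := fun v => by simp
  have h1' := h1.nonneg
  have h2' := h2.nonneg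
  rcases h1 with ⟨rfl, rfl⟩ | ⟨rfl, rfl⟩ <;> rcases h2 with ⟨rfl, rfl⟩ | ⟨rfl, rfl⟩
  · have := h0 x.1.1; linarith
  · linarith
  · rw [dist_comm']; linarith
  · have := h0 x.1.2.1; linarith

lemma mgDist_triangle (hG : G.Connected) (x y z : MGPoint G) :
    mgDist G x z ≤ mgDist G x y + mgDist G y z := by
  rcases mgDist_cases hG x y with h | ⟨e, s, f, t, h1, h2, h⟩
  · rcases mgDist_cases hG y z with h' | ⟨e', s', f', t', h1', h2', h'⟩
    · obtain ⟨q, hq, hq'⟩ := h.trans h'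
      exact (mgDist_le_loc hq).trans hq'
    · obtain ⟨s, hs, hs', _⟩ := h.end_transfer h1'
      have := mgDist_le_ends hs h2'
      linarith
  · rcases mgDist_cases hG y z with h' | ⟨e', s', f', t', h1', h2', h'⟩
    · obtain ⟨s, hs, hs', _⟩ := (isLoc_symm h').end_transfer h2
      have := mgDist_le_ends h1 hs
      linarith
    · have := mgDist_le_ends h1 h2'
      have a1 := dist_ends y h2 h1'
      have a2 := dist_tri hG e f f'
      have a3 := dist_tri hG f e' f'
      linarith

lemma mgVDist_tri (hG : G.Connected) (v w : V) (x : MGPoint G) :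
    mgVDist G v x ≤ G.dist v w + mgVDist G w x := by
  obtain ⟨e, s, he, h⟩ := mgVDist_cases w x
  have := mgVDist_le he v
  have := dist_tri hG v w e
  linarith

lemma mgVDist_nonneg (v : V) (x : MGPoint G) : 0 ≤ mgVDist G v x := by
  obtain ⟨e, s, he, h⟩ := mgVDist_cases v x
  have := he.nonneg; have : (0:ℝ) ≤ G.dist v e := Nat.cast_nonneg _; linarith

lemma mgDist_le_via (hG : G.Connected) (v : V) (x y : MGPoint G) :
    mgDist G x y ≤ mgVDist G v x + mgVDist G v y := by
  obtain ⟨e, s, he, h⟩ := mgVDist_cases v x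
  obtain ⟨f, t, hf, h'⟩ := mgVDist_cases v y
  have := mgDist_le_ends he hf
  have := dist_tri hG e v f
  rw [dist_comm' e v] at this
  linarith

lemma dist_le_via (hG : G.Connected) (v w : V) (x : MGPoint G) :
    (G.dist v w : ℝ) ≤ mgVDist G v x + mgVDist G w x := by
  obtain ⟨e, s, he, h⟩ := mgVDist_cases v x
  obtain ⟨f, t, hf, h'⟩ := mgVDist_cases w x
  have := dist_ends x he hf
  have := dist_tri hG v e w
  have := dist_tri hG e f w
  rw [dist_comm' f w] at this
  linarith

lemma mgVDist_le_add (hG : G.Connected) (v : V) (x y : MGPoint G) :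
    mgVDist G v x ≤ mgVDist G v y + mgDist G x y := by
  rcases mgDist_cases hG x y with h | ⟨e, s, f, t, h1, h2, h⟩
  · obtain ⟨e, t, he, h'⟩ := mgVDist_cases v y
    obtain ⟨s, hs, hs', _⟩ := h.end_transfer he
    have := mgVDist_le hs v
    linarith
  · obtain ⟨e', t', he, h'⟩ := mgVDist_cases v y
    have := mgVDist_le h1 v
    have := dist_ends y he h2
    have := dist_tri hG v e' e
    have := dist_tri hG e' f e
    rw [dist_comm' f e] at this
    linarith

/-- Distance from a vertex (as a point) is `mgVDist`. -/
lemma mgDist_vertex (hG : G.Connected) {x : MGPoint G} {v : V} (hv : IsEnd x v 0) (y : MGPoint G) :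
    mgDist G x y = mgVDist G v y := by
  have h0 : mgVDist G v x ≤ 0 := by simpa using mgVDist_le hv v
  apply le_antisymm
  · have := mgDist_le_via hG v x y
    linarith
  · have := mgVDist_le_add hG v y x
    rw [mgDist_comm hG y x] at this
    linarith

lemma mgVDist_vertex (hG : G.Connected) {x : MGPoint G} {v : V} (hv : IsEnd x v 0) (w : V) :
    mgVDist G w x = G.dist w v := by
  apply le_antisymm
  · simpa using mgVDist_le hv w
  · have := dist_le_via hG w v x
    have h0 : mgVDist G v x ≤ 0 := by simpa using mgVDist_le hv v
    linarith

lemma mgDist_le_bound (x y : MGPoint G) : mgDist G x y ≤ Fintype.card V + 1 := by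
  have hx := x.2.2
  have hy := y.2.2
  simp only [Set.mem_Icc] at hx hy
  unfold mgDist mgDistAux
  refine le_trans (min_le_left _ _) (le_trans (min_le_left _ _) ?_)
  split_ifs
  · have : |x.1.2.2 - y.1.2.2| ≤ 1 := by rw [abs_le]; constructor <;> linarith
    have h : (0:ℝ) ≤ Fintype.card V := by positivity
    linarith
  · exact le_rfl

end basics
end MGH

open SimpleGraph Set

set_option linter.unusedSectionVars false
set_option linter.unusedVariables false
namespace MGH
section framework

variable {V : Type} [Fintype V] [DecidableEq V] {G : SimpleGraph V}

/-- A property is locally stable on `Q`. -/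
def LocStable (G : SimpleGraph V) (Q : Set (MGPoint G)) (A : MGPoint G → Prop) : Prop :=
  ∀ q ∈ Q, ∃ ε > 0, ∀ q' ∈ Q, mgDist G q q' < ε → (A q ↔ A q')

def QConn (G : SimpleGraph V) (Q : Set (MGPoint G)) : Prop :=
  ∀ A : MGPoint G → Prop, LocStable G Q A → ∀ x ∈ Q, ∀ y ∈ Q, A x → A y

lemma mgDist_congr_right (hG : G.Connected) {x y : MGPoint G} (h : mgDist G x y = 0)
    (z : MGPoint G) : mgDist G z x = mgDist G z y := by
  have h1 := mgDist_triangle hG z x y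
  have h2 := mgDist_triangle hG z y x
  rw [mgDist_comm hG y x] at h2
  linarith

lemma mgDist_congr_left (hG : G.Connected) {x y : MGPoint G} (h : mgDist G x y = 0)
    (z : MGPoint G) : mgDist G x z = mgDist G y z := by
  rw [mgDist_comm hG x, mgDist_comm hG y]; exact mgDist_congr_right hG h z

lemma geod_stable {Q : Set (MGPoint G)} {A : MGPoint G → Prop} (hA : LocStable G Q A)
    {a b : ℝ} {γ : ℝ → MGPoint G} (hγ : IsMGGeodesic G a b γ)
    (hQ : ∀ s ∈ Set.Icc a b, γ s ∈ Q) :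
    ∀ s ∈ Set.Icc a b, ∀ t ∈ Set.Icc a b, (A (γ s) ↔ A (γ t)) := by
  intro s hs t ht
  have : PreconnectedSpace (Set.Icc a b) := Subtype.preconnectedSpace isPreconnected_Icc
  have hlc : IsLocallyConstant (fun r : Set.Icc a b => A (γ r.1)) := by
    rw [IsLocallyConstant.iff_eventually_eq]
    intro r
    obtain ⟨ε, hε, h⟩ := hA (γ r.1) (hQ _ r.2)
    have : ∀ᶠ r' in nhds r, Dist.dist r' r < ε := Metric.eventually_nhds_iff.2 ⟨ε, hε, fun _ h => h⟩
    filter_upwards [this] with r' hr'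
    apply propext
    refine (h (γ r'.1) (hQ _ r'.2) ?_).symm
    rw [hγ.2 _ r.2 _ r'.2, abs_sub_comm]
    exact hr'
  have := hlc.apply_eq_of_preconnectedSpace ⟨s, hs⟩ ⟨t, ht⟩
  exact iff_of_eq this

/-- The key hypothesis: no bad configuration at scale `B`. -/
def NoBad (G : SimpleGraph V) (B : ℝ) : Prop :=
  ∀ (p x y : MGPoint G) (Q : Set (MGPoint G)), QConn G Q → x ∈ Q → y ∈ Q →
    mgDist G x y = mgDist G x p + mgDist G p y → (∀ q ∈ Q, B < mgDist G p q) → False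

lemma side_close (hG : G.Connected) {B : ℝ} (hB : NoBad G B)
    {a1 b1 a2 b2 a3 b3 : ℝ} {g1 g2 g3 : ℝ → MGPoint G}
    (h1 : IsMGGeodesic G a1 b1 g1) (h2 : IsMGGeodesic G a2 b2 g2) (h3 : IsMGGeodesic G a3 b3 g3)
    (glue1 : mgDist G (g1 b1) (g2 a2) = 0) (glue2 : mgDist G (g2 b2) (g3 a3) = 0)
    (glue3 : mgDist G (g3 b3) (g1 a1) = 0) {s : ℝ} (hs : s ∈ Set.Icc a1 b1) :
    (∃ t ∈ Set.Icc a2 b2, mgDist G (g1 s) (g2 t) ≤ B) ∨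
      (∃ t ∈ Set.Icc a3 b3, mgDist G (g1 s) (g3 t) ≤ B) := by
  by_contra hcon
  push Not at hcon
  obtain ⟨c2, c3⟩ := hcon
  have l1 := left_mem_Icc.2 h1.1
  have r1 := right_mem_Icc.2 h1.1
  have l2 := left_mem_Icc.2 h2.1
  have r2 := right_mem_Icc.2 h2.1
  have l3 := left_mem_Icc.2 h3.1
  have r3 := right_mem_Icc.2 h3.1
  refine hB (g1 s) (g3 b3) (g2 a2) (g2 '' Set.Icc a2 b2 ∪ g3 '' Set.Icc a3 b3) ?_
    (Or.inr ⟨_, r3, rfl⟩) (Or.inl ⟨_, l2, rfl⟩) ?_ ?_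
  · intro A hA
    have s2 := geod_stable hA h2 (fun s hs => Or.inl ⟨_, hs, rfl⟩)
    have s3 := geod_stable hA h3 (fun s hs => Or.inr ⟨_, hs, rfl⟩)
    have hg : A (g2 b2) ↔ A (g3 a3) := by
      obtain ⟨ε, hε, h⟩ := hA (g2 b2) (Or.inl ⟨_, r2, rfl⟩)
      exact h _ (Or.inr ⟨_, l3, rfl⟩) (by rw [glue2]; exact hε)
    have all : ∀ q ∈ (g2 '' Set.Icc a2 b2 ∪ g3 '' Set.Icc a3 b3), (A q ↔ A (g2 b2)) := by
      rintro q (⟨t, ht, rfl⟩ | ⟨t, ht, rfl⟩)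
      · exact s2 _ ht _ r2
      · rw [hg]; exact s3 _ ht _ l3
    intro x hx y hy hax
    rw [all y hy, ← all x hx]; exact hax
  · rw [mgDist_congr_left hG glue3, mgDist_congr_left hG glue3, ← mgDist_congr_right hG glue1,
      ← mgDist_congr_right hG glue1, h1.2 _ l1 _ r1, h1.2 _ l1 _ hs, h1.2 _ hs _ r1]
    obtain ⟨hs1, hs2⟩ := hs
    have := h1.1
    rw [abs_of_nonpos (by linarith), abs_of_nonpos (by linarith), abs_of_nonpos (by linarith)]
    ring
  · rintro q (⟨t, ht, rfl⟩ | ⟨t, ht, rfl⟩)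
    · exact c2 _ ht
    · exact c3 _ ht

lemma triangleDelta_le (hG : G.Connected) {B : ℝ} (hB0 : 0 ≤ B) (hB : NoBad G B)
    (T : MGTriangle G) : triangleDelta T ≤ B := by
  apply csInf_le ⟨0, fun d hd => hd.1⟩
  refine ⟨hB0, fun s hs => ?_, fun s hs => ?_, fun s hs => ?_⟩
  · exact side_close hG hB T.h1 T.h2 T.h3 T.glue1 T.glue2 T.glue3 hs
  · exact (side_close hG hB T.h2 T.h3 T.h1 T.glue2 T.glue3 T.glue1 hs).symm
  · exact side_close hG hB T.h3 T.h1 T.h2 T.glue3 T.glue1 T.glue2 hs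

lemma hypDelta_le (hG : G.Connected) {B : ℝ} (hB0 : 0 ≤ B) (hB : NoBad G B) : hypDelta G ≤ B := by
  apply Real.sSup_le _ hB0
  rintro d ⟨T, rfl⟩
  exact triangleDelta_le hG hB0 hB T

lemma triangleDelta_nonneg (T : MGTriangle G) : 0 ≤ triangleDelta T :=
  Real.sInf_nonneg (fun _ hd => hd.1)

lemma hypDelta_nonneg : 0 ≤ hypDelta G :=
  Real.sSup_nonneg (fun _ ⟨T, hT⟩ => hT ▸ triangleDelta_nonneg T)

lemma noBad_card (hG : G.Connected) : NoBad G (Fintype.card V + 1) := by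
  intro p x y Q _ hx _ _ h
  exact absurd (h x hx) (not_lt.2 (mgDist_le_bound p x))

lemma triangleDelta_le_hypDelta (hG : G.Connected) (T : MGTriangle G) :
    triangleDelta T ≤ hypDelta G := by
  apply le_csSup
  · refine ⟨Fintype.card V + 1, ?_⟩
    rintro d ⟨T, rfl⟩
    exact triangleDelta_le hG (by positivity) (noBad_card hG) T
  · exact ⟨T, rfl⟩

end framework
end MGH

open SimpleGraph Set

set_option linter.unusedSectionVars false
set_option linter.unusedVariables false
namespace MGH
section thmC

variable {V : Type} [Fintype V] [DecidableEq V] {G : SimpleGraph V}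

lemma seqWalk {G : SimpleGraph V} (c : ℕ → V) (lo m : ℕ)
    (h : ∀ i, lo ≤ i → i < lo + m → G.Adj (c i) (c (i + 1))) :
    ∃ w : G.Walk (c lo) (c (lo + m)), w.length = m ∧
      (∀ v, v ∈ w.support ↔ ∃ i, lo ≤ i ∧ i ≤ lo + m ∧ v = c i) ∧
      ((∀ i j, lo ≤ i → i < j → j ≤ lo + m → c i ≠ c j) → w.IsPath) := by
  induction m with
  | zero =>
    refine ⟨Walk.nil, rfl, fun v => ?_, fun _ => Walk.IsPath.nil⟩
    simp only [Walk.support_nil, List.mem_singleton, Nat.add_zero]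
    constructor
    · rintro rfl; exact ⟨lo, le_rfl, le_rfl, rfl⟩
    · rintro ⟨i, h1, h2, rfl⟩; rw [le_antisymm h2 h1]
  | succ m ih =>
    obtain ⟨w, hl, hs, hp⟩ := ih (fun i h1 h2 => h i h1 (by omega))
    refine ⟨w.concat (h (lo + m) (by omega) (by omega)), ?_, fun v => ?_, fun hinj => ?_⟩
    · rw [Walk.length_concat, hl]
    · rw [Walk.support_concat, List.mem_append, hs, List.mem_singleton]
      constructor
      · rintro (⟨i, h1, h2, rfl⟩ | rfl)
        · exact ⟨i, h1, by omega, rfl⟩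
        · exact ⟨lo + m + 1, by omega, by omega, rfl⟩
      · rintro ⟨i, h1, h2, rfl⟩
        rcases Nat.lt_or_ge i (lo + m + 1) with h3 | h3
        · left; exact ⟨i, h1, by omega, rfl⟩
        · right; rw [show i = lo + m + 1 by omega]; rfl
    · apply (hp (fun i j a b c => hinj i j a b (by omega))).concat
      rw [hs]
      rintro ⟨i, h1, h2, h3⟩
      exact hinj i (lo + m + 1) h1 (by omega) (by omega) h3.symm

lemma seq_dist_le (hG : G.Connected) (c : ℕ → V) (n : ℕ) (h : ∀ i, i < n → G.Adj (c i) (c (i + 1)))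
    {i j : ℕ} (hij : i ≤ j) (hj : j ≤ n) : (G.dist (c i) (c j) : ℝ) ≤ j - i := by
  obtain ⟨m, rfl⟩ := Nat.exists_eq_add_of_le hij
  obtain ⟨w, hl, -, -⟩ := seqWalk c i m (fun k h1 h2 => h k (by omega))
  have := SimpleGraph.dist_le w
  rw [hl] at this
  have h2 : (G.dist (c i) (c (i + m)) : ℝ) ≤ m := by exact_mod_cast this
  push_cast; linarith

/-- Subgraph avoiding a set of vertices. -/
def avoid (G : SimpleGraph V) (S : Set V) : SimpleGraph V where
  Adj u v := G.Adj u v ∧ u ∉ S ∧ v ∉ S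
  symm := ⟨fun u v h => ⟨h.1.symm, h.2.2, h.2.1⟩⟩
  loopless := ⟨fun u h => G.loopless.irrefl u h.1⟩

lemma avoid_le (S : Set V) : avoid G S ≤ G := fun _ _ h => h.1

lemma avoid_walk_support {S : Set V} {a b : V} (w : (avoid G S).Walk a b) (ha : a ∉ S) :
    ∀ v ∈ w.support, v ∉ S := by
  induction w with
  | nil => intro v hv; simp only [Walk.support_nil, List.mem_singleton] at hv; rw [hv]; exact ha
  | cons h p ih =>
    intro v hv
    rw [Walk.support_cons, List.mem_cons] at hv
    rcases hv with rfl | hv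
    · exact ha
    · exact ih h.2.2 v hv

lemma avoid_reach_notMem {S : Set V} {a b : V} (h : (avoid G S).Reachable a b) (ha : a ∉ S) :
    b ∉ S := by
  obtain ⟨w⟩ := h
  exact avoid_walk_support w ha b w.end_mem_support

lemma avoid_of_walk {S : Set V} {a b : V} (w : G.Walk a b) (h : ∀ v ∈ w.support, v ∉ S) :
    (avoid G S).Reachable a b := by
  induction w with
  | nil => exact Reachable.refl _
  | cons h' p ih =>
    have h1 := ih (fun v hv => h v (by rw [Walk.support_cons]; exact List.mem_cons_of_mem _ hv))
    refine Reachable.trans (Adj.reachable ⟨h', h _ (by simp), h _ ?_⟩) h1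
    rw [Walk.support_cons]; exact List.mem_cons_of_mem _ p.start_mem_support

lemma walk_dist_left (hG : G.Connected) {a b v : V} (w : G.Walk a b) (hv : v ∈ w.support) :
    G.dist v a ≤ w.length := by
  have h1 := SimpleGraph.dist_le (w.takeUntil v hv)
  have h2 := w.length_takeUntil_le_length hv
  rw [SimpleGraph.dist_comm]; omega

/-- Ends reachable property. -/
def Col (G : SimpleGraph V) (S : Set V) (a0 : V) (q : MGPoint G) : Prop :=
  ∃ e s, IsEnd q e s ∧ (avoid G S).Reachable a0 e

lemma col_iff {S : Set V} {a0 : V} (ha : a0 ∉ S) {q : MGPoint G} {e : V} {s : ℝ} (he : IsEnd q e s)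
    (heS : e ∉ S) : Col G S a0 q ↔ (avoid G S).Reachable a0 e := by
  constructor
  · rintro ⟨f, t, hf, hr⟩
    obtain ⟨e', hadj, -, hall⟩ := he.other
    rcases hall f t hf with ⟨rfl, -⟩ | ⟨rfl, -⟩
    · exact hr
    · exact hr.trans (Adj.reachable ⟨hadj.symm, avoid_reach_notMem hr ha, heS⟩)
  · intro h; exact ⟨e, s, he, h⟩

lemma col_stable (hG : G.Connected) {S : Set V} (hS : S.Nonempty) {a0 : V} (ha : a0 ∉ S)
    {Q : Set (MGPoint G)} (hQ : ∀ q ∈ Q, ∀ v ∈ S, 0 < mgVDist G v q) :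
    LocStable G Q (Col G S a0) := by
  intro q hq
  obtain ⟨v0, hv0, hmin⟩ := Set.exists_min_image S (fun v => mgVDist G v q) (Set.toFinite S) hS
  refine ⟨mgVDist G v0 q, hQ q hq v0 hv0, fun q' hq' hd => ?_⟩
  rcases mgDist_cases hG q q' with h | ⟨e, s, f, t, h1, h2, h⟩
  · have key : ∀ x y : MGPoint G, ∀ r, IsLoc x y r → Col G S a0 y → Col G S a0 x := by
      rintro x y r hl ⟨e, s, he, hr⟩
      obtain ⟨s', hs', -⟩ := hl.end_transfer he
      exact ⟨e, s', hs', hr⟩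
    exact ⟨key _ _ _ (isLoc_symm h), key _ _ _ h⟩
  · have ht := h2.nonneg.1
    obtain ⟨w, hw⟩ := hG.exists_walk_length_eq_dist e f
    have hav : ∀ v ∈ w.support, v ∉ S := by
      intro v hv hvS
      have a1 := walk_dist_left hG w hv
      rw [hw] at a1
      have a2 : (G.dist v e : ℝ) ≤ G.dist e f := by exact_mod_cast a1
      have a3 := mgVDist_le h1 v
      have a4 := hmin v hvS
      linarith
    have hr := avoid_of_walk w hav
    rw [col_iff ha h1 (hav _ w.start_mem_support), col_iff ha h2 (hav _ w.end_mem_support)]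
    exact ⟨fun h => h.trans hr, fun h => h.trans hr.symm⟩

lemma cons_cycle {u v : V} (h : G.Adj u v) (p : G.Walk v u) (hp : p.IsPath) (hl : 2 ≤ p.length) :
    (Walk.cons h p).IsCycle := by
  rw [Walk.isCycle_iff_isPath_tail_and_le_length]
  refine ⟨?_, by rw [Walk.length_cons]; omega⟩
  have : (Walk.cons h p).tail.support = p.support := by
    rw [Walk.support_tail_of_not_nil _ (by simp)]; simp
  rw [Walk.isPath_def, this]; exact hp.support_nodup

/-- Core construction of a cycle from a carrier sequence. -/
lemma coreC (hG : G.Connected) {β : ℝ} (hβ : 1 / 2 ≤ β) {p x y : MGPoint G} {Q : Set (MGPoint G)}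
    (hQ : QConn G Q) (hx : x ∈ Q) (hy : y ∈ Q) (hfar : ∀ q ∈ Q, β < mgDist G p q)
    (c : ℕ → V) (n : ℕ) (hn : 1 ≤ n) (hc : ∀ i, i < n → G.Adj (c i) (c (i + 1)))
    {ξ η T : ℝ} (hx0 : IsEnd x (c 0) ξ) (hx1 : IsEnd x (c 1) (1 - ξ))
    (hyn : IsEnd y (c n) (n - η)) (hyn1 : IsEnd y (c (n - 1)) (1 - (n - η)))
    (hxy : mgDist G x y = η - ξ) (hT1 : β < T - ξ) (hT2 : β < η - T)
    (hp : ∀ i : ℕ, 1 ≤ i → i ≤ n - 1 → mgVDist G (c i) p ≤ |(i : ℝ) - T|) :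
    ∃ (a : V) (Z : G.Walk a a), Z.IsCycle ∧ ∃ a0 ∈ Z.support, ∃ a1 ∈ Z.support,
      ∃ b0 ∈ Z.support, ∃ b1 ∈ Z.support,
      4 * β < 2 + G.dist a0 b0 + G.dist a1 b1 ∧ 2 + G.dist a0 b0 + G.dist a1 b1 ≤ Z.length := by
  obtain ⟨ξ0, ξ1⟩ := hx0.nonneg
  obtain ⟨η0, η1⟩ := hyn.nonneg
  have hdx : ∀ i : ℕ, i ≤ n → mgVDist G (c i) x ≤ |(i : ℝ) - ξ| := by
    intro i hi
    rcases Nat.eq_zero_or_pos i with rfl | hi0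
    · have := mgVDist_le hx0 (c 0)
      rw [SimpleGraph.dist_self] at this
      push_cast at this ⊢
      rw [abs_of_nonpos (by linarith)]; linarith
    · have h1 : (1 : ℝ) ≤ i := by exact_mod_cast hi0
      have := mgVDist_le hx1 (c i)
      have h2 := seq_dist_le hG c n hc hi0 hi
      rw [dist_comm'] at h2
      push_cast at h2
      rw [abs_of_nonneg (by linarith)]; linarith
  have hdy : ∀ i : ℕ, i ≤ n → mgVDist G (c i) y ≤ |η - i| := by
    intro i hi
    rcases Nat.eq_or_lt_of_le hi with rfl | hi0
    · have := mgVDist_le hyn (c i)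
      rw [SimpleGraph.dist_self] at this
      push_cast at this ⊢
      rw [abs_of_nonpos (by linarith)]; linarith
    · have h1 : (i : ℝ) + 1 ≤ n := by exact_mod_cast hi0
      have := mgVDist_le hyn1 (c i)
      have h2 := seq_dist_le hG c n hc (show i ≤ n - 1 by omega) (by omega)
      rw [Nat.cast_sub hn] at h2
      push_cast at h2
      rw [abs_of_nonneg (by linarith)]; linarith
  have hD : ∀ i j : ℕ, i ≤ n → j ≤ n → η - ξ ≤ |(i : ℝ) - ξ| + G.dist (c i) (c j) + |η - j| := by
    intro i j hi hj
    have h1 := mgDist_le_via hG (c i) x y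
    have h2 := mgVDist_tri hG (c i) (c j) y
    have := hdx i hi
    have := hdy j hj
    linarith
  -- indices
  set lo := ⌈T - β⌉₊ with hlo
  set hi := ⌊T + β⌋₊ with hhi
  have hTβ : 0 < T - β := by linarith
  have lo1 : 1 ≤ lo := Nat.one_le_iff_ne_zero.2 (by rw [hlo]; exact (Nat.ceil_pos.2 hTβ).ne')
  have lo_ge : T - β ≤ lo := Nat.le_ceil _
  have lo_lt : (lo : ℝ) < T - β + 1 := Nat.ceil_lt_add_one hTβ.le
  have hi_le : (hi : ℝ) ≤ T + β := Nat.floor_le (by linarith)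
  have hi_gt : T + β < hi + 1 := Nat.lt_floor_add_one _
  have hi_n : hi + 1 ≤ n := by
    have : (hi : ℝ) < n := by linarith
    exact_mod_cast this
  have lohi : lo ≤ hi := Nat.le_floor (by linarith)
  obtain ⟨m, hm⟩ := Nat.exists_eq_add_of_le lohi
  have hnn : ((n - 1 : ℕ) : ℝ) = n - 1 := by rw [Nat.cast_sub hn]; simp
  set S : Set V := {v | ∃ i, lo ≤ i ∧ i ≤ hi ∧ v = c i} with hS
  have hξi : ∀ i : ℕ, 1 ≤ i → |(i : ℝ) - ξ| = i - ξ := fun i h => by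
    have : (1 : ℝ) ≤ i := by exact_mod_cast h
    exact abs_of_nonneg (by linarith)
  have hηi : ∀ i : ℕ, i ≤ n - 1 → |η - i| = η - i := fun i h => by
    have : (i : ℝ) ≤ (n - 1 : ℕ) := by exact_mod_cast h
    rw [hnn] at this
    exact abs_of_nonneg (by linarith)
  have hne : ∀ i j : ℕ, 1 ≤ i → i < j → j ≤ n - 1 → c i ≠ c j := by
    intro i j h1 h2 h3 h
    have := hD i j (by omega) (by omega)
    rw [hξi i h1, hηi j h3, h, SimpleGraph.dist_self] at this
    have : (i : ℝ) < j := by exact_mod_cast h2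
    push_cast at *
    linarith
  have ha0 : c (lo - 1) ∉ S := by
    rintro ⟨j, h1, h2, h3⟩
    rcases Nat.eq_or_lt_of_le lo1 with h4 | h4
    · have h5 : lo - 1 = 0 := by omega
      rw [h5] at h3
      have := hD 0 j (by omega) (by omega)
      rw [hηi j (by omega), h3, SimpleGraph.dist_self] at this
      have hlo' : (lo : ℝ) = 1 := by exact_mod_cast h4.symm
      push_cast at this
      rw [abs_of_nonpos (by linarith)] at this
      have : (j : ℝ) < 2 := by linarith
      have : j < 2 := by exact_mod_cast this
      have : j = 1 := by omega
      subst this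
      exact (hc 0 (by omega)).ne h3
    · exact hne (lo - 1) j (by omega) (by omega) (by omega) h3
  have hb0 : c (hi + 1) ∉ S := by
    rintro ⟨j, h1, h2, h3⟩
    rcases Nat.eq_or_lt_of_le hi_n with h4 | h4
    · have := hD j (hi + 1) (by omega) (by omega)
      rw [hξi j (by omega), h3, SimpleGraph.dist_self] at this
      have hn' : (n : ℝ) = hi + 1 := by exact_mod_cast h4.symm
      push_cast at this
      rw [abs_of_nonpos (by linarith)] at this
      have : (hi : ℝ) < j + 1 := by linarith
      have : hi < j + 1 := by exact_mod_cast this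
      have : j = hi := by omega
      subst this
      exact (hc hi (by omega)).ne h3.symm
    · exact hne j (hi + 1) (by omega) (by omega) (by omega) h3.symm
  have hSn : S.Nonempty := ⟨c lo, lo, le_rfl, lohi, rfl⟩
  have hSp : ∀ v ∈ S, mgVDist G v p ≤ β := by
    rintro v ⟨i, h1, h2, rfl⟩
    refine (hp i (by omega) (by omega)).trans ?_
    have : (lo : ℝ) ≤ i := by exact_mod_cast h1
    have : (i : ℝ) ≤ hi := by exact_mod_cast h2
    rw [abs_le]; constructor <;> linarith
  have hSQ : ∀ q ∈ Q, ∀ v ∈ S, 0 < mgVDist G v q := by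
    intro q hq v hv
    have := hfar q hq
    have := hSp v hv
    have := mgDist_le_via hG v p q
    linarith
  have hstab := col_stable hG hSn ha0 hSQ
  -- x is coloured
  have hlow : ∀ i, 1 ≤ i → i < lo → c i ∉ S := by
    rintro i h1 h2 ⟨j, h3, h4, h5⟩
    exact hne i j h1 (by omega) (by omega) h5
  have hhigh : ∀ i, hi < i → i ≤ n - 1 → c i ∉ S := by
    rintro i h1 h2 ⟨j, h3, h4, h5⟩
    exact hne j i (by omega) (by omega) (by omega) h5.symm
  have hcx : Col G S (c (lo - 1)) x := by
    rcases Nat.eq_or_lt_of_le lo1 with h4 | h4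
    · exact ⟨c 0, ξ, hx0, by rw [show lo - 1 = 0 by omega]⟩
    · refine ⟨c 1, 1 - ξ, hx1, Reachable.symm ?_⟩
      obtain ⟨w, -, hw, -⟩ := seqWalk c 1 (lo - 2) (fun i h1 h2 => hc i (by omega))
      rw [show lo - 1 = 1 + (lo - 2) by omega]
      refine avoid_of_walk w (fun v hv => ?_)
      obtain ⟨i, h1, h2, rfl⟩ := (hw v).1 hv
      exact hlow i h1 (by omega)
  have hcy := hQ _ hstab x hx y hy hcx
  have hreach : (avoid G S).Reachable (c (hi + 1)) (c (lo - 1)) := by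
    rcases Nat.eq_or_lt_of_le hi_n with h4 | h4
    · rw [h4]
      rw [h4] at hb0
      exact ((col_iff ha0 hyn hb0).1 hcy).symm
    · have h5 := (col_iff ha0 hyn1 (hhigh (n - 1) (by omega) le_rfl)).1 hcy
      refine Reachable.trans ?_ h5.symm
      obtain ⟨w, -, hw, -⟩ := seqWalk c (hi + 1) (n - 1 - (hi + 1)) (fun i h1 h2 => hc i (by omega))
      have hlast : c (hi + 1 + (n - 1 - (hi + 1))) = c (n - 1) := by congr 1; omega
      rw [← hlast]
      refine avoid_of_walk w (fun v hv => ?_)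
      obtain ⟨i, h1, h2, rfl⟩ := (hw v).1 hv
      exact hhigh i (by omega) (by omega)
  obtain ⟨P0, hP0⟩ := hreach.exists_isPath
  obtain ⟨W, hWl, hWs, hWp⟩ := seqWalk c lo m (fun i h1 h2 => hc i (by omega))
  have hWpath := hWp (fun i j h1 h2 h3 => hne i j (by omega) h2 (by omega))
  have hP := hP0.mapLe (avoid_le S)
  set P : G.Walk (c (hi + 1)) (c (lo - 1)) := P0.mapLe (avoid_le S) with hPdef
  have hPs : ∀ v ∈ P.support, v ∉ S := by
    intro v hv
    rw [hPdef, Walk.support_mapLe_eq_support] at hv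
    exact avoid_walk_support P0 hb0 v hv
  have hadj1 : G.Adj (c (lo - 1)) (c lo) := by
    have := hc (lo - 1) (by omega)
    rwa [show lo - 1 + 1 = lo by omega] at this
  have hadj2 : G.Adj (c (lo + m)) (c (hi + 1)) := by rw [← hm]; exact hc hi (by omega)
  have hlen : (G.dist (c (lo - 1)) (c (hi + 1)) : ℝ) ≤ P.length := by
    have := SimpleGraph.dist_le P
    rw [SimpleGraph.dist_comm] at this
    exact_mod_cast this
  have hmR : (hi : ℝ) = lo + m := by exact_mod_cast hm
  have hd1 : (G.dist (c lo) (c hi) : ℝ) = m := by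
    apply le_antisymm
    · have := seq_dist_le hG c n hc lohi (by omega)
      linarith
    · have := hD lo hi (by omega) (by omega)
      rw [hξi lo lo1, hηi hi (by omega)] at this
      linarith
  have hlo1R : ((lo - 1 : ℕ) : ℝ) = lo - 1 := by rw [Nat.cast_sub lo1]; simp
  have hmain : 4 * β < m + 2 + G.dist (c (lo - 1)) (c (hi + 1)) := by
    have := hD (lo - 1) (hi + 1) (by omega) (by omega)
    rw [hlo1R] at this
    push_cast at this
    rcases abs_cases ((lo : ℝ) - 1 - ξ) with h | h <;>
      rcases abs_cases (η - ((hi : ℝ) + 1)) with h' | h' <;> linarith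
  refine ⟨c (lo - 1), Walk.cons hadj1 (W.append (Walk.cons hadj2 P)), ?_, c (lo - 1), ?_,
    c lo, ?_, c (hi + 1), ?_, c hi, ?_, ?_, ?_⟩
  · refine cons_cycle hadj1 _ ?_ ?_
    · rw [Walk.isPath_def, Walk.support_append,
        Walk.support_cons, List.tail_cons]
      refine List.Nodup.append hWpath.support_nodup hP.support_nodup ?_
      intro v h1 h2
      obtain ⟨i, h3, h4, rfl⟩ := (hWs v).1 h1
      exact hPs _ h2 ⟨i, h3, by omega, rfl⟩
    · simp only [Walk.length_cons, Walk.length_append, hWl]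
      have : (2 : ℝ) < m + 2 + P.length := by linarith
      have : 2 < m + 2 + P.length := by exact_mod_cast this
      omega
  · simp
  · simp
  · simp
  · have h1 : c hi ∈ W.support := (hWs _).2 ⟨hi, lohi, hm.le, rfl⟩
    rw [Walk.support_cons, Walk.support_append]
    exact List.mem_cons_of_mem _ (List.mem_append_left _ h1)
  · rw [hd1]; linarith
  · simp only [Walk.length_cons, Walk.length_append, hWl]
    have h1 : (2 + G.dist (c (lo - 1)) (c (hi + 1)) + G.dist (c lo) (c hi) : ℝ) ≤
      m + (P.length + 1) + 1 := by linarith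
    exact_mod_cast h1

end thmC
end MGH

open SimpleGraph Set

set_option linter.unusedSectionVars false
set_option linter.unusedVariables false
namespace MGH
section thmC2

variable {V : Type} [Fintype V] [DecidableEq V] {G : SimpleGraph V}

/-- Conclusion of the cycle theorem. -/
def BigCycle (G : SimpleGraph V) (β : ℝ) : Prop :=
  ∃ (a : V) (Z : G.Walk a a), Z.IsCycle ∧ ∃ a0 ∈ Z.support, ∃ a1 ∈ Z.support,
      ∃ b0 ∈ Z.support, ∃ b1 ∈ Z.support,
      4 * β < 2 + G.dist a0 b0 + G.dist a1 b1 ∧ 2 + G.dist a0 b0 + G.dist a1 b1 ≤ Z.length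

lemma coreW (hG : G.Connected) {β : ℝ} (hβ : 1 / 2 ≤ β) {p x y : MGPoint G} {Q : Set (MGPoint G)}
    (hQ : QConn G Q) (hx : x ∈ Q) (hy : y ∈ Q) (hfar : ∀ q ∈ Q, β < mgDist G p q)
    {e f : V} {s t τ : ℝ} (hxe : IsEnd x e s) (hyf : IsEnd y f t) (w : G.Walk e f)
    (hp : ∀ i : ℕ, i ≤ w.length → mgVDist G (w.getVert i) p ≤ |(i : ℝ) - τ|)
    (hxy : mgDist G x y = s + w.length + t) (hxp : mgDist G x p = s + τ)
    (hpy : mgDist G p y = w.length - τ + t) : BigCycle G β := by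
  obtain ⟨e', he', hxe', -⟩ := hxe.other
  obtain ⟨f', hf', hyf', -⟩ := hyf.other
  set k := w.length with hk
  let c : ℕ → V := fun i => if i = 0 then e' else if i ≤ k + 1 then w.getVert (i - 1) else f'
  have c0 : c 0 = e' := by simp [c]
  have cm : ∀ i, i ≤ k → c (i + 1) = w.getVert i := by
    intro i hi
    simp only [c]
    rw [if_neg (by omega), if_pos (by omega)]
    rfl
  have cl : c (k + 2) = f' := by
    simp only [c]
    rw [if_neg (by omega), if_neg (by omega)]
  have c1 : c 1 = e := by rw [show (1:ℕ) = 0 + 1 by rfl, cm 0 (by omega), Walk.getVert_zero]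
  have ck : c (k + 1) = f := by rw [cm k le_rfl, hk, Walk.getVert_length]
  have fx := hfar x hx
  have fy := hfar y hy
  rw [mgDist_comm hG] at fx
  refine coreC hG hβ hQ hx hy hfar c (k + 2) (by omega) ?_ (ξ := 1 - s) (η := k + 1 + t) (T := τ + 1)
    (by rw [c0]; exact hxe') (by rw [c1]; convert hxe using 1; ring)
    (by rw [cl]; convert hyf' using 1; push_cast; ring)
    (by rw [show k + 2 - 1 = k + 1 by omega, ck]; convert hyf using 1; push_cast; ring)
    (by rw [hxy]; ring) (by linarith) (by linarith) ?_
  · intro i hi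
    rcases Nat.eq_zero_or_pos i with rfl | h
    · rw [c0, show 0 + 1 = 1 by rfl, c1]; exact he'.symm
    · obtain ⟨j, rfl⟩ : ∃ j, i = j + 1 := ⟨i - 1, by omega⟩
      rcases Nat.lt_or_ge j k with h' | h'
      · rw [cm j (by omega), cm (j + 1) (by omega)]
        exact w.adj_getVert_succ h'
      · have : j = k := by omega
        subst this
        rw [ck, show k + 1 + 1 = k + 2 by rfl, cl]; exact hf'
  · intro i h1 h2
    obtain ⟨j, rfl⟩ : ∃ j, i = j + 1 := ⟨i - 1, by omega⟩
    rw [cm j (by omega)]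
    refine (hp j (by omega)).trans (le_of_eq ?_)
    congr 1; push_cast; ring

lemma walk_getVert_dist (hG : G.Connected) {e f : V} (w : G.Walk e f) {i j : ℕ} (hij : i ≤ j)
    (hj : j ≤ w.length) : (G.dist (w.getVert i) (w.getVert j) : ℝ) ≤ j - i :=
  seq_dist_le hG w.getVert w.length (fun i hi => w.adj_getVert_succ hi) hij hj

lemma isLoc_le_one {x y : MGPoint G} {r : ℝ} (h : IsLoc x y r) : r ≤ 1 := by
  have hx := x.2.2
  have hy := y.2.2
  simp only [Set.mem_Icc] at hx hy
  rcases h with ⟨_, _, rfl⟩ | ⟨_, _, rfl⟩ <;> rw [abs_le] <;> constructor <;> linarith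

/-- Local position: an end reached from `x` after passing `p`, and an end on the other side. -/
lemma IsLoc.exists_between {x p : MGPoint G} {r : ℝ} (h : IsLoc x p r) :
    ∃ u v s t, IsEnd x u s ∧ IsEnd x v (1 - s) ∧ IsEnd p u t ∧ IsEnd p v (1 - t) ∧ t = s + r ∧
      ∀ f t', IsEnd p f t' → (f = u ∧ t' = t) ∨ (f = v ∧ t' = 1 - t) := by
  have key : ∃ u v s t, IsEnd x u s ∧ IsEnd x v (1 - s) ∧ IsEnd p u t ∧ IsEnd p v (1 - t) ∧
      r = |s - t| ∧ ∀ f t', IsEnd p f t' → (f = u ∧ t' = t) ∨ (f = v ∧ t' = 1 - t) := by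
    rcases h with ⟨h1, h2, rfl⟩ | ⟨h1, h2, rfl⟩
    · refine ⟨x.1.1, x.1.2.1, x.1.2.2, p.1.2.2, isEnd_left x, isEnd_right x, Or.inl ⟨h1, rfl⟩,
        Or.inr ⟨h2, rfl⟩, rfl, ?_⟩
      rintro f t' (⟨h3, h4⟩ | ⟨h3, h4⟩)
      · exact Or.inl ⟨h3.trans h1.symm, h4⟩
      · exact Or.inr ⟨h3.trans h2.symm, h4⟩
    · refine ⟨x.1.1, x.1.2.1, x.1.2.2, 1 - p.1.2.2, isEnd_left x, isEnd_right x, Or.inr ⟨h1, rfl⟩,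
        Or.inl ⟨h2, by ring⟩, rfl, ?_⟩
      rintro f t' (⟨h3, h4⟩ | ⟨h3, h4⟩)
      · exact Or.inr ⟨h3.trans h2.symm, by linarith⟩
      · exact Or.inl ⟨h3.trans h1.symm, h4⟩
  obtain ⟨u, v, s, t, h1, h2, h3, h4, h5, h8⟩ := key
  rcases abs_cases (s - t) with ⟨h6, h7⟩ | ⟨h6, h7⟩
  · refine ⟨v, u, 1 - s, 1 - t, h2, ?_, h4, ?_, by linarith, ?_⟩
    · convert h1 using 1; ring
    · convert h3 using 1; ring
    · intro f t' hf
      rcases h8 f t' hf with h | h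
      · exact Or.inr ⟨h.1, by linarith [h.2]⟩
      · exact Or.inl h
  · exact ⟨u, v, s, t, h1, h2, h3, h4, by linarith, h8⟩

lemma caseLN (hG : G.Connected) {β : ℝ} (hβ : 1 / 2 ≤ β) {p x y : MGPoint G} {Q : Set (MGPoint G)}
    (hQ : QConn G Q) (hx : x ∈ Q) (hy : y ∈ Q) (hfar : ∀ q ∈ Q, β < mgDist G p q)
    (hxpy : mgDist G x y = mgDist G x p + mgDist G p y)
    (hL : IsLoc x p (mgDist G x p))
    {e f : V} {s t : ℝ} (h1 : IsEnd p e s) (h2 : IsEnd y f t)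
    (hN : mgDist G p y = s + G.dist e f + t) : BigCycle G β := by
  obtain ⟨u, v, sx, sp, a1, a2, a3, a4, a5, a6⟩ := hL.exists_between
  have hpos : 0 < mgDist G x p := by have := hfar x hx; rw [mgDist_comm hG] at this; linarith
  rcases a6 e s h1 with ⟨rfl, rfl⟩ | ⟨rfl, rfl⟩
  · have := mgDist_le_ends a1 h2
    linarith
  · obtain ⟨w, hw⟩ := hG.exists_walk_length_eq_dist e f
    have hw' : (G.dist e f : ℝ) = w.length := by exact_mod_cast hw.symm
    have hb := a3.nonneg
    refine coreW hG hβ hQ hx hy hfar a2 h2 w (τ := -(1 - sp)) ?_ (by linarith) (by linarith)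
      (by linarith)
    intro i hi
    have b1 := walk_getVert_dist hG w (Nat.zero_le i) hi
    rw [Walk.getVert_zero, dist_comm'] at b1
    have b2 := mgVDist_le a4 (w.getVert i)
    push_cast at b1
    have : (0:ℝ) ≤ i := Nat.cast_nonneg _
    rw [abs_of_nonneg (by linarith)]
    linarith

lemma caseNN (hG : G.Connected) {β : ℝ} (hβ : 1 / 2 ≤ β) {p x y : MGPoint G} {Q : Set (MGPoint G)}
    (hQ : QConn G Q) (hx : x ∈ Q) (hy : y ∈ Q) (hfar : ∀ q ∈ Q, β < mgDist G p q)
    (hxpy : mgDist G x y = mgDist G x p + mgDist G p y)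
    {e f e1 f1 : V} {s t s1 t1 : ℝ} (h1 : IsEnd x e s) (h2 : IsEnd p f t)
    (hN : mgDist G x p = s + G.dist e f + t)
    (h3 : IsEnd p e1 s1) (h4 : IsEnd y f1 t1)
    (hN1 : mgDist G p y = s1 + G.dist e1 f1 + t1) : BigCycle G β := by
  obtain ⟨w, hw⟩ := hG.exists_walk_length_eq_dist e f
  have hw' : (G.dist e f : ℝ) = w.length := by exact_mod_cast hw.symm
  obtain ⟨w1, hw1⟩ := hG.exists_walk_length_eq_dist e1 f1
  have hw1' : (G.dist e1 f1 : ℝ) = w1.length := by exact_mod_cast hw1.symm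
  obtain ⟨f', hadj, hf', hall⟩ := h2.other
  have ht := h2.nonneg
  have hs := h3.nonneg
  rcases hall e1 s1 h3 with ⟨rfl, rfl⟩ | ⟨rfl, rfl⟩
  · have b1 := mgDist_le_ends h1 h4
    have b2 := dist_tri hG e e1 f1
    have hs0 : s1 = 0 := by linarith
    subst hs0
    have hl : ((w.append w1).length : ℝ) = w.length + w1.length := by
      rw [Walk.length_append]; push_cast; ring
    refine coreW hG hβ hQ hx hy hfar h1 h4 (w.append w1) (τ := w.length) ?_ (by linarith)
      (by linarith) (by linarith)
    intro i hi
    have hg : (w.append w1).getVert w.length = e1 := by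
      rw [Walk.getVert_append]; simp
    have hwl : w.length ≤ (w.append w1).length := by rw [Walk.length_append]; omega
    have c1 := mgVDist_le h2 ((w.append w1).getVert i)
    rcases Nat.le_total i w.length with h | h
    · have c2 := walk_getVert_dist hG (w.append w1) h hwl
      rw [hg] at c2
      have : (i : ℝ) ≤ w.length := by exact_mod_cast h
      rw [abs_of_nonpos (by linarith)]; linarith
    · have c2 := walk_getVert_dist hG (w.append w1) h hi
      rw [hg, dist_comm'] at c2
      have : (w.length : ℝ) ≤ i := by exact_mod_cast h
      rw [abs_of_nonneg (by linarith)]; linarith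
  · set W := w.append (Walk.cons hadj w1) with hW
    have hlN : W.length = w.length + w1.length + 1 := by
      rw [hW, Walk.length_append, Walk.length_cons]; omega
    have hl : (W.length : ℝ) = w.length + w1.length + 1 := by rw [hlN]; push_cast; ring
    refine coreW hG hβ hQ hx hy hfar h1 h4 W (τ := w.length + t) ?_ (by linarith)
      (by linarith) (by linarith)
    intro i hi
    have hg : W.getVert w.length = f := by
      rw [hW, Walk.getVert_append]; simp
    have hg1 : W.getVert (w.length + 1) = e1 := by
      rw [hW, Walk.getVert_append]; simp
    rcases Nat.lt_or_ge i (w.length + 1) with h | h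
    · have c1 := mgVDist_le h2 (W.getVert i)
      have c2 := walk_getVert_dist hG W (show i ≤ w.length by omega) (by omega)
      rw [hg] at c2
      have : (i : ℝ) ≤ w.length := by exact_mod_cast (show i ≤ w.length by omega)
      rw [abs_of_nonpos (by linarith)]; linarith
    · have c1 := mgVDist_le h3 (W.getVert i)
      have c2 := walk_getVert_dist hG W h hi
      rw [hg1, dist_comm'] at c2
      have : (w.length : ℝ) + 1 ≤ i := by exact_mod_cast h
      push_cast at c2
      rw [abs_of_nonneg (by linarith)]; linarith

theorem thmC (hG : G.Connected) {β : ℝ} (hβ : 1 / 2 ≤ β) (h : ¬ BigCycle G β) : NoBad G β := by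
  intro p x y Q hQ hx hy hxpy hfar
  apply h
  rcases mgDist_cases hG x p with hL | ⟨e, s, f, t, h1, h2, hN⟩
  · rcases mgDist_cases hG p y with hL' | ⟨e1, s1, f1, t1, h3, h4, hN1⟩
    · exfalso
      obtain ⟨q, hq, hq'⟩ := hL.trans hL'
      have := mgDist_le_loc hq
      have := isLoc_le_one hq
      have f1 := hfar x hx
      have f2 := hfar y hy
      rw [mgDist_comm hG] at f1
      linarith
    · exact caseLN hG hβ hQ hx hy hfar hxpy hL h3 h4 hN1
  · rcases mgDist_cases hG p y with hL' | ⟨e1, s1, f1, t1, h3, h4, hN1⟩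
    · refine caseLN hG hβ hQ hy hx hfar ?_ ?_ h2 h1 (e := f) (f := e) ?_
      · rw [mgDist_comm hG y x, mgDist_comm hG y p, mgDist_comm hG p x, hxpy]; ring
      · rw [mgDist_comm hG y p]; exact isLoc_symm hL'
      · rw [mgDist_comm hG p x, hN, dist_comm']; ring
    · exact caseNN hG hβ hQ hx hy hfar hxpy h1 h2 hN h3 h4 hN1

lemma circ_bdd (G : SimpleGraph V) :
    BddAbove {n : ℕ | ∃ (a : V) (w : G.Walk a a), w.IsCycle ∧ w.length = n} := by
  refine ⟨Fintype.card V, ?_⟩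
  rintro n ⟨a, w, hw, rfl⟩
  have h1 := hw.support_nodup
  have h2 := h1.length_le_card
  simpa using h2

lemma cycle_le_circ {a : V} (w : G.Walk a a) (hw : w.IsCycle) : w.length ≤ circumference G :=
  le_csSup (circ_bdd G) ⟨a, w, hw, rfl⟩

/-- `δ(G) ≤ c(G)/4`. -/
theorem hypDelta_le_circ (hG : G.Connected) (hc : 3 ≤ circumference G) :
    hypDelta G ≤ (circumference G : ℝ) / 4 := by
  have h3 : (3 : ℝ) ≤ circumference G := by exact_mod_cast hc
  apply hypDelta_le hG (by linarith)
  apply thmC hG (by linarith)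
  rintro ⟨a, Z, hZ, a0, -, a1, -, b0, -, b1, -, h1, h2⟩
  have h4 := cycle_le_circ Z hZ
  have : (2 + G.dist a0 b0 + G.dist a1 b1 : ℝ) ≤ circumference G := by exact_mod_cast h2.trans h4
  linarith

end thmC2
end MGH

open SimpleGraph Set

set_option linter.unusedSectionVars false
set_option linter.unusedVariables false
namespace MGH
section ladder

variable {V : Type} [Fintype V] [DecidableEq V] {G : SimpleGraph V}

lemma ladder_abs (hG : G.Connected) (lev : MGPoint G → ℝ) (R : Set ℝ) (l : ℝ)
    (hlip : ∀ x y, |lev x - lev y| ≤ mgDist G x y)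
    (hb : ∀ ρ ∈ R, ∀ x y, mgDist G x y ≤ |lev x - ρ| + |lev y - ρ| + 1)
    (hgap : ∀ x, ∃ ρ1 ∈ R, ∃ ρ2 ∈ R, ρ1 ≤ lev x ∧ lev x ≤ ρ2 ∧ ρ2 - ρ1 ≤ l) :
    NoBad G (1 + l / 2) := by
  have key : ∀ (p x y : MGPoint G) (Q : Set (MGPoint G)), QConn G Q → x ∈ Q → y ∈ Q →
    mgDist G x y = mgDist G x p + mgDist G p y → (∀ q ∈ Q, 1 + l / 2 < mgDist G p q) →
    lev x ≤ lev y → False := by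
    intro p x y Q hQ hx hy hxpy hfar hle
    have f1 := hfar x hx
    have f2 := hfar y hy
    rw [mgDist_comm hG] at f1
    obtain ⟨ρ1, hρ1, ρ2, hρ2, g1, g2, g3⟩ := hgap x
    have hd : mgDist G x y ≤ lev y - lev x + 1 := by
      by_cases hc : ρ2 ≤ lev y
      · have := hb ρ2 hρ2 x y
        rw [abs_of_nonpos (by linarith), abs_of_nonneg (by linarith)] at this
        linarith
      · exfalso
        push Not at hc
        have h1 := hb ρ2 hρ2 x y
        rw [abs_of_nonpos (by linarith), abs_of_nonpos (by linarith)] at h1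
        have h2 := hb ρ1 hρ1 x y
        rw [abs_of_nonneg (by linarith), abs_of_nonneg (by linarith)] at h2
        linarith
    have l1 := abs_le.1 (hlip x p)
    have l2 := abs_le.1 (hlip p y)
    obtain ⟨σ1, hσ1, σ2, hσ2, k1, k2, k3⟩ := hgap p
    obtain ⟨ρ, hρ, hρp⟩ : ∃ ρ ∈ R, |lev p - ρ| ≤ l / 2 := by
      by_cases hc : lev p - σ1 ≤ l / 2
      · exact ⟨σ1, hσ1, by rw [abs_of_nonneg (by linarith)]; exact hc⟩
      · exact ⟨σ2, hσ2, by rw [abs_of_nonpos (by linarith)]; linarith⟩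
    have hρp' := abs_le.1 hρp
    have hq : ∃ q ∈ Q, lev q = ρ := by
      by_contra hcon
      push Not at hcon
      have hst : LocStable G Q (fun q => lev q < ρ) := by
        intro q hq
        refine ⟨|lev q - ρ|, abs_pos.2 (sub_ne_zero.2 (hcon q hq)), fun q' hq' hd => ?_⟩
        have := abs_le.1 (hlip q q')
        rcases abs_cases (lev q - ρ) with ⟨h1, h2⟩ | ⟨h1, h2⟩
        · constructor <;> intro h <;> linarith
        · constructor <;> intro h <;> linarith
      have hlt := hQ _ hst x hx y hy (by linarith)
      linarith
    obtain ⟨q, hqQ, hq⟩ := hq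
    have h1 := hb ρ hρ p q
    have h2 := hfar q hqQ
    rw [hq, sub_self, abs_zero] at h1
    linarith
  intro p x y Q hQ hx hy hxpy hfar
  rcases le_total (lev x) (lev y) with h | h
  · exact key p x y Q hQ hx hy hxpy hfar h
  · refine key p y x Q hQ hy hx ?_ hfar h
    rw [mgDist_comm hG y x, mgDist_comm hG y p, mgDist_comm hG p x, hxpy]; ring

/-- Interpolated level. -/
noncomputable def lev (h : V → ℤ) (x : MGPoint G) : ℝ :=
  (1 - x.1.2.2) * h x.1.1 + x.1.2.2 * h x.1.2.1

lemma level_adj {h : V → ℤ} (hh : ∀ u v, G.Adj u v → |h u - h v| ≤ 1) {u v : V} (ha : G.Adj u v) :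
    |(h u : ℝ) - h v| ≤ 1 := by exact_mod_cast hh u v ha

lemma level_dist (hG : G.Connected) {h : V → ℤ} (hh : ∀ u v, G.Adj u v → |h u - h v| ≤ 1) (u v : V) :
    |(h u : ℝ) - h v| ≤ G.dist u v := by
  obtain ⟨w, hw⟩ := hG.exists_walk_length_eq_dist u v
  rw [← hw]
  clear hw
  induction w with
  | nil => simp
  | cons ha p ih =>
    have h1 := level_adj hh ha
    rw [Walk.length_cons]
    push_cast
    rw [abs_le] at *
    constructor <;> linarith

lemma lev_end {h : V → ℤ} (hh : ∀ u v, G.Adj u v → |h u - h v| ≤ 1) {x : MGPoint G} {e : V} {s : ℝ}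
    (he : IsEnd x e s) : |lev h x - h e| ≤ s := by
  have h1 := abs_le.1 (level_adj hh x.2.1)
  have hs := he.nonneg
  unfold lev
  rcases he with ⟨rfl, rfl⟩ | ⟨rfl, rfl⟩ <;> rw [abs_le] <;> constructor <;> nlinarith

lemma lev_lip (hG : G.Connected) {h : V → ℤ} (hh : ∀ u v, G.Adj u v → |h u - h v| ≤ 1)
    (x y : MGPoint G) : |lev h x - lev h y| ≤ mgDist G x y := by
  rcases mgDist_cases hG x y with hl | ⟨e, s, f, t, h1, h2, h3⟩
  · have h1 := level_adj hh x.2.1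
    generalize mgDist G x y = r at hl
    have aux : ∀ d r : ℝ, |d| = r → ∀ a b : ℝ, |a - b| ≤ 1 → |d * (a - b)| ≤ r := by
      intro d r hd a b hab
      rw [abs_mul, hd]
      have : 0 ≤ r := hd ▸ abs_nonneg _
      nlinarith
    rcases hl with ⟨a1, a2, a3⟩ | ⟨a1, a2, a3⟩
    · have := aux _ _ a3.symm _ _ h1
      unfold lev
      rw [← abs_neg]
      convert this using 2
      rw [← a1, ← a2]; ring
    · have := aux _ _ a3.symm _ _ h1
      unfold lev
      rw [← abs_neg]
      convert this using 2
      rw [← a1, ← a2]; ring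
  · have a1 := lev_end hh h1
    have a2 := lev_end hh h2
    have a3 := level_dist hG hh e f
    rw [h3]
    rw [abs_le] at *
    constructor <;> linarith

lemma pt_rung (hG : G.Connected) {h : V → ℤ} (hh : ∀ u v, G.Adj u v → |h u - h v| ≤ 1)
    (ty : V → Prop) (hty : ∀ u v, G.Adj u v → h u = h v → ¬ (ty u ↔ ty v))
    {ρ : ℤ} {a b : V} (hab : G.dist a b ≤ 1)
    (h1 : ∀ v, ty v → (G.dist v a : ℝ) ≤ |(h v : ℝ) - ρ|)
    (h2 : ∀ v, ¬ ty v → (G.dist v b : ℝ) ≤ |(h v : ℝ) - ρ|) (x : MGPoint G) :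
    ∃ s : ℝ, mgVDist G a x ≤ |lev h x - ρ| + s ∧ mgVDist G b x ≤ |lev h x - ρ| + (1 - s) := by
  have hab' : (G.dist a b : ℝ) ≤ 1 := by exact_mod_cast hab
  have near : ∀ w s, IsEnd x w s → |lev h x - ρ| = |(h w : ℝ) - ρ| + s →
      ∃ s : ℝ, mgVDist G a x ≤ |lev h x - ρ| + s ∧ mgVDist G b x ≤ |lev h x - ρ| + (1 - s) := by
    intro w s hw hd
    have a1 := mgVDist_le hw a
    have a2 := mgVDist_le hw b
    by_cases ht : ty w
    · have a3 := h1 w ht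
      rw [dist_comm'] at a3
      have a4 := dist_tri hG b a w
      rw [dist_comm' b a] at a4
      exact ⟨0, by linarith, by linarith⟩
    · have a3 := h2 w ht
      rw [dist_comm'] at a3
      have a4 := dist_tri hG a b w
      exact ⟨1, by linarith, by linarith⟩
  have hadj := x.2.1
  have e1 := isEnd_left x
  have e2 := isEnd_right x
  have hlev : lev h x = (1 - x.1.2.2) * h x.1.1 + x.1.2.2 * h x.1.2.1 := rfl
  have ht := e1.nonneg
  generalize x.1.2.2 = t at *
  generalize x.1.1 = u at *
  generalize x.1.2.1 = v at *
  have hd := abs_le.1 (hh u v hadj)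
  rcases lt_trichotomy (h u) (h v) with hlt | heq | hgt
  · have hv : h v = h u + 1 := by omega
    have hv' : (h v : ℝ) = h u + 1 := by exact_mod_cast hv
    rw [hv'] at hlev
    have hlev' : lev h x = h u + t := by rw [hlev]; ring
    rcases le_or_gt ρ (h u) with hr | hr
    · have hr' : (ρ : ℝ) ≤ h u := by exact_mod_cast hr
      refine near _ _ e1 ?_
      rw [abs_of_nonneg (by linarith), abs_of_nonneg (by linarith)]; linarith
    · have hr' : (h u : ℝ) + 1 ≤ ρ := by exact_mod_cast hr
      refine near _ _ e2 ?_
      rw [abs_of_nonpos (by linarith), abs_of_nonpos (by linarith)]; linarith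
  · have heq' : (h u : ℝ) = h v := by exact_mod_cast heq
    have hlev' : lev h x = h u := by rw [hlev, heq']; ring
    have hne := hty u v hadj heq
    have a1 := mgVDist_le e1 a
    have a2 := mgVDist_le e1 b
    have a3 := mgVDist_le e2 a
    have a4 := mgVDist_le e2 b
    rw [hlev']
    by_cases hu : ty u
    · have hv : ¬ ty v := fun hv => hne ⟨fun _ => hv, fun _ => hu⟩
      have b1 := h1 u hu
      have b2 := h2 v hv
      rw [← heq'] at b2
      rw [dist_comm'] at b1 b2
      exact ⟨t, by linarith, by linarith⟩
    · have hv : ty v := by by_contra hv; exact hne ⟨fun h => absurd h hu, fun h => absurd h hv⟩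
      have b1 := h2 u hu
      have b2 := h1 v hv
      rw [← heq'] at b2
      rw [dist_comm'] at b1 b2
      exact ⟨1 - t, by linarith, by linarith⟩
  · have hv : h u = h v + 1 := by omega
    have hv' : (h u : ℝ) = h v + 1 := by exact_mod_cast hv
    rw [hv'] at hlev
    have hlev' : lev h x = h v + (1 - t) := by rw [hlev]; ring
    rcases le_or_gt ρ (h v) with hr | hr
    · have hr' : (ρ : ℝ) ≤ h v := by exact_mod_cast hr
      refine near _ _ e2 ?_
      rw [abs_of_nonneg (by linarith), abs_of_nonneg (by linarith)]; linarith
    · have hr' : (h v : ℝ) + 1 ≤ ρ := by exact_mod_cast hr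
      refine near _ _ e1 ?_
      rw [abs_of_nonpos (by linarith), abs_of_nonpos (by linarith)]; linarith

/-- Upper bound for ladder-like graphs. -/
theorem ladder_bound (hG : G.Connected) {h : V → ℤ} (hh : ∀ u v, G.Adj u v → |h u - h v| ≤ 1)
    (ty : V → Prop) (hty : ∀ u v, G.Adj u v → h u = h v → ¬ (ty u ↔ ty v))
    (R : Set ℤ) (l : ℕ)
    (hR : ∀ ρ ∈ R, ∃ a b, G.dist a b ≤ 1 ∧ (∀ v, ty v → (G.dist v a : ℤ) ≤ |h v - ρ|) ∧
      (∀ v, ¬ ty v → (G.dist v b : ℤ) ≤ |h v - ρ|))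
    (hgap : ∀ u v, G.Adj u v → h u ≤ h v → ∃ ρ1 ∈ R, ∃ ρ2 ∈ R, ρ1 ≤ h u ∧ h v ≤ ρ2 ∧ ρ2 - ρ1 ≤ l) :
    hypDelta G ≤ 1 + (l : ℝ) / 2 := by
  apply hypDelta_le hG (by positivity)
  apply ladder_abs hG (lev h) ((fun z : ℤ => (z : ℝ)) '' R) l (lev_lip hG hh)
  · rintro _ ⟨ρ, hρ, rfl⟩ x y
    obtain ⟨a, b, h0, h1, h2⟩ := hR ρ hρ
    have h1' : ∀ v, ty v → (G.dist v a : ℝ) ≤ |(h v : ℝ) - ρ| := fun v hv => by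
      exact_mod_cast h1 v hv
    have h2' : ∀ v, ¬ ty v → (G.dist v b : ℝ) ≤ |(h v : ℝ) - ρ| := fun v hv => by
      exact_mod_cast h2 v hv
    obtain ⟨s, s1, s2⟩ := pt_rung hG hh ty hty h0 h1' h2' x
    obtain ⟨s', s1', s2'⟩ := pt_rung hG hh ty hty h0 h1' h2' y
    have k1 := mgDist_le_via hG a x y
    have k2 := mgDist_le_via hG b x y
    simp only
    linarith
  · intro x
    have hadj := x.2.1
    have ht := (isEnd_left x).nonneg
    have hlev : lev h x = (1 - x.1.2.2) * h x.1.1 + x.1.2.2 * h x.1.2.1 := rfl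
    generalize x.1.2.2 = t at *
    generalize x.1.1 = u at *
    generalize x.1.2.1 = v at *
    rcases le_total (h u) (h v) with hc | hc
    · obtain ⟨ρ1, h1, ρ2, h2, h3, h4, h5⟩ := hgap u v hadj hc
      have h3' : (ρ1 : ℝ) ≤ h u := by exact_mod_cast h3
      have h4' : (h v : ℝ) ≤ ρ2 := by exact_mod_cast h4
      have hc' : (h u : ℝ) ≤ h v := by exact_mod_cast hc
      refine ⟨ρ1, ⟨ρ1, h1, rfl⟩, ρ2, ⟨ρ2, h2, rfl⟩, ?_, ?_, by exact_mod_cast h5⟩ <;> nlinarith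
    · obtain ⟨ρ1, h1, ρ2, h2, h3, h4, h5⟩ := hgap v u hadj.symm hc
      have h3' : (ρ1 : ℝ) ≤ h v := by exact_mod_cast h3
      have h4' : (h u : ℝ) ≤ ρ2 := by exact_mod_cast h4
      have hc' : (h v : ℝ) ≤ h u := by exact_mod_cast hc
      refine ⟨ρ1, ⟨ρ1, h1, rfl⟩, ρ2, ⟨ρ2, h2, rfl⟩, ?_, ?_, by exact_mod_cast h5⟩ <;> nlinarith

end ladder
end MGH

open SimpleGraph Set

set_option linter.unusedSectionVars false
set_option linter.unusedVariables false
namespace MGH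
section lower

variable {V : Type} [Fintype V] [DecidableEq V] {G : SimpleGraph V}

/-- Point at parameter `s` on a vertex sequence. -/
noncomputable def pt (w : ℕ → V) (n : ℕ) (hn : 1 ≤ n) (hw : ∀ i, i < n → G.Adj (w i) (w (i + 1)))
    (s : ℝ) : MGPoint G :=
  ⟨(w (min ⌊s⌋₊ (n - 1)), w (min ⌊s⌋₊ (n - 1) + 1),
      max 0 (min 1 (s - (min ⌊s⌋₊ (n - 1) : ℕ)))),
    hw _ (by omega), le_max_left _ _, max_le zero_le_one (min_le_left _ _)⟩

variable {w : ℕ → V} {n : ℕ} {hn : 1 ≤ n} {hw : ∀ i, i < n → G.Adj (w i) (w (i + 1))}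

lemma pt_val_aux {s : ℝ} {i : ℕ} (hi : min ⌊s⌋₊ (n - 1) = i) (h1 : (i : ℝ) ≤ s) (h2 : s ≤ i + 1) :
    (pt w n hn hw s).1 = (w i, w (i + 1), s - i) := by
  subst hi
  unfold pt
  simp only [Prod.mk.injEq, true_and]
  rw [min_eq_right (by linarith), max_eq_right (by linarith)]

lemma pt_val {s : ℝ} {i : ℕ} (hi : i < n) (h1 : (i : ℝ) ≤ s) (h2 : s < i + 1) :
    (pt w n hn hw s).1 = (w i, w (i + 1), s - i) := by
  apply pt_val_aux _ h1 h2.le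
  have : ⌊s⌋₊ = i := (Nat.floor_eq_iff (by have := Nat.cast_nonneg (α := ℝ) i; linarith)).2 ⟨h1, h2⟩
  rw [this]; omega

lemma pt_idx (hn : 1 ≤ n) {s : ℝ} (h0 : 0 ≤ s) (hs : s ≤ n) :
    ((min ⌊s⌋₊ (n - 1) : ℕ) : ℝ) ≤ s ∧ s ≤ (min ⌊s⌋₊ (n - 1) : ℕ) + 1 := by
  have h1 := Nat.floor_le h0
  have h2 := Nat.lt_floor_add_one s
  rcases Nat.le_total ⌊s⌋₊ (n - 1) with h | h
  · rw [min_eq_left h]; exact ⟨h1, h2.le⟩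
  · rw [min_eq_right h]
    have : ((n - 1 : ℕ) : ℝ) ≤ ⌊s⌋₊ := by exact_mod_cast h
    have h3 : ((n - 1 : ℕ) : ℝ) = n - 1 := by rw [Nat.cast_sub hn]; simp
    constructor <;> linarith

/-- Complete description of ends. -/
def HasEnds (x : MGPoint G) (u : V) (s : ℝ) (v : V) (t : ℝ) : Prop :=
  IsEnd x u s ∧ IsEnd x v t ∧ ∀ f r, IsEnd x f r → (f = u ∧ r = s) ∨ (f = v ∧ r = t)

lemma hasEnds_of_val {x : MGPoint G} {u v : V} {s t : ℝ} (h : x.1 = (u, v, s)) (ht : t = 1 - s) :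
    HasEnds x u s v t := by
  have h1 : x.1.1 = u := by rw [h]
  have h2 : x.1.2.1 = v := by rw [h]
  have h3 : x.1.2.2 = s := by rw [h]
  refine ⟨Or.inl ⟨h1.symm, h3.symm⟩, Or.inr ⟨h2.symm, by rw [h3, ht]⟩, ?_⟩
  rintro f r (⟨a, b⟩ | ⟨a, b⟩)
  · exact Or.inl ⟨a.trans h1, b.trans h3⟩
  · exact Or.inr ⟨a.trans h2, by rw [b, h3, ht]⟩

lemma pt_ends {s : ℝ} (h0 : 0 ≤ s) (hs : s ≤ n) :
    ∃ i : ℕ, i < n ∧ (i : ℝ) ≤ s ∧ s ≤ i + 1 ∧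
      HasEnds (pt w n hn hw s) (w i) (s - i) (w (i + 1)) (i + 1 - s) := by
  obtain ⟨h1, h2⟩ := pt_idx hn h0 hs
  exact ⟨_, by omega, h1, h2, hasEnds_of_val (pt_val_aux rfl h1 h2) (by ring)⟩

lemma pt_dist_le (hG : G.Connected) {s t : ℝ} (h0 : 0 ≤ s) (hst : s ≤ t) (ht : t ≤ n) :
    mgDist G (pt w n hn hw s) (pt w n hn hw t) ≤ t - s := by
  obtain ⟨h1, h2⟩ := pt_idx hn h0 (hst.trans ht)
  obtain ⟨h3, h4⟩ := pt_idx hn (h0.trans hst) ht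
  have v1 := pt_val_aux (w := w) (n := n) (hn := hn) (hw := hw) rfl h1 h2
  have v2 := pt_val_aux (w := w) (n := n) (hn := hn) (hw := hw) rfl h3 h4
  have hmono : min ⌊s⌋₊ (n - 1) ≤ min ⌊t⌋₊ (n - 1) := min_le_min_right _ (Nat.floor_mono hst)
  have hlt : min ⌊t⌋₊ (n - 1) < n := by omega
  generalize min ⌊s⌋₊ (n - 1) = i at *
  generalize min ⌊t⌋₊ (n - 1) = j at *
  rcases Nat.eq_or_lt_of_le hmono with h | h
  · subst h
    apply mgDist_le_loc
    left
    rw [v1, v2]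
    refine ⟨rfl, rfl, ?_⟩
    rw [abs_of_nonpos] <;> simp only <;> linarith
  · have e1 := (hasEnds_of_val v1 rfl).2.1
    have e2 := (hasEnds_of_val v2 rfl).1
    have := mgDist_le_ends e1 e2
    have h5 := seq_dist_le hG w n hw (show i + 1 ≤ j by omega) hlt.le
    push_cast at h5
    linarith

lemma pt_geod (hG : G.Connected) {a b : ℝ} (h0 : 0 ≤ a) (hab : a ≤ b) (hb : b ≤ n)
    (hd : b - a ≤ mgDist G (pt w n hn hw a) (pt w n hn hw b)) :
    IsMGGeodesic G a b (pt w n hn hw) := by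
  have key : ∀ s t, a ≤ s → s ≤ t → t ≤ b →
      mgDist G (pt w n hn hw s) (pt w n hn hw t) = t - s := by
    intro s t h1 h2 h3
    apply le_antisymm (pt_dist_le hG (by linarith) h2 (by linarith))
    have k1 := mgDist_triangle hG (pt w n hn hw a) (pt w n hn hw s) (pt w n hn hw b)
    have k2 := mgDist_triangle hG (pt w n hn hw s) (pt w n hn hw t) (pt w n hn hw b)
    have k3 := pt_dist_le (hn := hn) (hw := hw) hG h0 h1 (by linarith : s ≤ n)
    have k4 := pt_dist_le (hn := hn) (hw := hw) hG (by linarith : 0 ≤ t) h3 hb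
    linarith
  refine ⟨hab, fun s hs t ht => ?_⟩
  rcases le_total s t with h | h
  · rw [key s t hs.1 h ht.2, abs_of_nonpos (by linarith)]; ring
  · rw [mgDist_comm hG, key t s ht.1 h hs.2, abs_of_nonneg (by linarith)]

/-- The bigon lemma. -/
lemma bigon (hG : G.Connected) {w' : ℕ → V} {n' : ℕ} {hn' : 1 ≤ n'}
    {hw' : ∀ i, i < n' → G.Adj (w' i) (w' (i + 1))} {a b s β : ℝ} (h0 : 0 ≤ a) (has : a ≤ s)
    (hsb : s ≤ b) (hb : b ≤ n) (hb' : b ≤ n')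
    (hd : b - a ≤ mgDist G (pt w n hn hw a) (pt w n hn hw b))
    (hd' : b - a ≤ mgDist G (pt w' n' hn' hw' a) (pt w' n' hn' hw' b))
    (m1 : mgDist G (pt w n hn hw a) (pt w' n' hn' hw' a) = 0)
    (m2 : mgDist G (pt w n hn hw b) (pt w' n' hn' hw' b) = 0)
    (hfar : ∀ t, a ≤ t → t ≤ b → β ≤ mgDist G (pt w n hn hw s) (pt w' n' hn' hw' t)) :
    β ≤ hypDelta G := by
  have g1 := pt_geod hG h0 (has.trans hsb) hb hd
  have g2 := pt_geod hG h0 (has.trans hsb) hb' hd'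
  have hab := has.trans hsb
  let T : MGTriangle G :=
    { a1 := a, b1 := b, a2 := a, b2 := b, a3 := 0, b3 := 0
      g1 := pt w n hn hw
      g2 := fun t => pt w' n' hn' hw' (a + b - t)
      g3 := fun _ => pt w' n' hn' hw' a
      h1 := g1
      h2 := by
        refine ⟨hab, fun s hs t ht => ?_⟩
        obtain ⟨hs1, hs2⟩ := hs
        obtain ⟨ht1, ht2⟩ := ht
        rw [g2.2 _ ⟨by linarith, by linarith⟩ _ ⟨by linarith, by linarith⟩,
          show a + b - s - (a + b - t) = -(s - t) by ring, abs_neg]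
      h3 := by
        refine ⟨le_rfl, fun s hs t ht => ?_⟩
        obtain ⟨hs1, hs2⟩ := hs
        obtain ⟨ht1, ht2⟩ := ht
        rw [mgDist_self hG, show s = 0 by linarith, show t = 0 by linarith]; simp
      glue1 := by rw [show a + b - a = b by ring]; exact m2
      glue2 := by rw [show a + b - b = a by ring]; exact mgDist_self hG _
      glue3 := by rw [mgDist_comm hG]; exact m1 }
  refine le_trans ?_ (triangleDelta_le_hypDelta hG T)
  apply le_csInf
  · have hB := noBad_card hG
    refine ⟨Fintype.card V + 1, by positivity, fun s hs => ?_, fun s hs => ?_, fun s hs => ?_⟩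
    · exact side_close hG hB T.h1 T.h2 T.h3 T.glue1 T.glue2 T.glue3 hs
    · exact (side_close hG hB T.h2 T.h3 T.h1 T.glue2 T.glue3 T.glue1 hs).symm
    · exact side_close hG hB T.h3 T.h1 T.h2 T.glue3 T.glue1 T.glue2 hs
  · rintro d ⟨-, hs1, -, -⟩
    rcases hs1 s ⟨has, hsb⟩ with ⟨t, ⟨ht1, ht2⟩, ht⟩ | ⟨t, ht1, ht⟩
    · exact (hfar (a + b - t) (by linarith [show t ≤ b from ht2])
        (by linarith [show a ≤ t from ht1])).trans ht
    · exact (hfar a le_rfl hab).trans ht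

lemma psi_dist (hG : G.Connected) {ψ : V → ℝ} (hψ : ∀ u v, G.Adj u v → |ψ u - ψ v| ≤ 1) (u v : V) :
    |ψ u - ψ v| ≤ G.dist u v := by
  obtain ⟨w, hw⟩ := hG.exists_walk_length_eq_dist u v
  rw [← hw]
  clear hw
  induction w with
  | nil => simp
  | cons ha p ih =>
    have h1 := hψ _ _ ha
    rw [Walk.length_cons]
    push_cast
    rw [abs_le] at *
    constructor <;> linarith

/-- Lower bound for distances. -/
lemma dist_lb (hG : G.Connected) {ψ : V → ℝ} (hψ : ∀ u v, G.Adj u v → |ψ u - ψ v| ≤ 1)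
    {p q : MGPoint G} {β : ℝ} {u v u' v' : V} {s t s' t' : ℝ} (hp : HasEnds p u s v t)
    (hq : HasEnds q u' s' v' t') (p1 : β ≤ s + ψ u) (p2 : β ≤ t + ψ v)
    (q1 : ψ u' ≤ s') (q2 : ψ v' ≤ t') (hnl : (u ≠ u' ∧ u ≠ v') ∨ (v ≠ u' ∧ v ≠ v')) :
    β ≤ mgDist G p q := by
  rcases mgDist_cases hG p q with h | ⟨e, s, f, t, h1, h2, h3⟩
  · exfalso
    have h := isLoc_symm h
    rcases hnl with ⟨a, b⟩ | ⟨a, b⟩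
    · obtain ⟨r, hr, -⟩ := h.end_transfer hp.1
      rcases hq.2.2 _ _ hr with c | c
      · exact a c.1
      · exact b c.1
    · obtain ⟨r, hr, -⟩ := h.end_transfer hp.2.1
      rcases hq.2.2 _ _ hr with c | c
      · exact a c.1
      · exact b c.1
  · have k := abs_le.1 (psi_dist hG hψ e f)
    have a1 : β ≤ s + ψ e := by
      rcases hp.2.2 _ _ h1 with ⟨rfl, rfl⟩ | ⟨rfl, rfl⟩ <;> assumption
    have a2 : ψ f ≤ t := by
      rcases hq.2.2 _ _ h2 with ⟨rfl, rfl⟩ | ⟨rfl, rfl⟩ <;> assumption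
    linarith

lemma pt_zero_end : IsEnd (pt w n hn hw 0) (w 0) 0 := by
  have := (hasEnds_of_val (pt_val (w := w) (n := n) (hn := hn) (hw := hw) (s := 0) (i := 0)
    (by omega) (by simp) (by simp)) rfl).1
  simpa using this

lemma pt_last_end : IsEnd (pt w n hn hw n) (w n) 0 := by
  obtain ⟨i, h1, h2, h3, h4⟩ := pt_ends (w := w) (n := n) (hn := hn) (hw := hw) (s := n)
    (by positivity) le_rfl
  have : n ≤ i + 1 := by exact_mod_cast h3
  obtain rfl : n = i + 1 := by omega
  have := h4.2.1
  simpa using this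

lemma pt_nat_end {j : ℕ} (hj : j ≤ n) : IsEnd (pt w n hn hw j) (w j) 0 := by
  rcases Nat.eq_or_lt_of_le hj with rfl | h
  · exact pt_last_end
  · have := (hasEnds_of_val (pt_val (w := w) (n := n) (hn := hn) (hw := hw) (s := j) (i := j)
      h le_rfl (by simp)) rfl).1
    simpa using this

/-- Distance from the start of a sequence which is geodesic. -/
lemma pt_start_lb (hG : G.Connected) {b : ℝ} (hb0 : (n : ℝ) - 1 ≤ b) (hb : b ≤ n)
    (h1 : ∀ i, i < n → G.dist (w 0) (w i) = i) (h2 : 2 * b - n ≤ G.dist (w 0) (w n)) :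
    b - 0 ≤ mgDist G (pt w n hn hw 0) (pt w n hn hw b) := by
  rw [mgDist_vertex hG pt_zero_end]
  have hn' : (1 : ℝ) ≤ n := by exact_mod_cast hn
  obtain ⟨i, hi, hi1, hi2, hE⟩ := pt_ends (w := w) (n := n) (hn := hn) (hw := hw) (s := b)
    (by linarith) hb
  obtain ⟨e, s, he, hes⟩ := mgVDist_cases (w 0) (pt w n hn hw b)
  rw [hes]
  rcases hE.2.2 _ _ he with ⟨rfl, rfl⟩ | ⟨rfl, rfl⟩
  · rw [h1 i hi]; linarith
  · rcases Nat.eq_or_lt_of_le (show i + 1 ≤ n by omega) with h | h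
    · have h' : (n : ℝ) = i + 1 := by exact_mod_cast h.symm
      rw [h]; linarith
    · rw [h1 _ h]; push_cast
      have : (i : ℝ) + 1 + 1 ≤ n := by exact_mod_cast h
      linarith

lemma match_zero (hG : G.Connected) {x y : MGPoint G} {v : V} (hx : IsEnd x v 0) (hy : IsEnd y v 0) :
    mgDist G x y = 0 := by
  rw [mgDist_vertex hG hx, mgVDist_vertex hG hy, SimpleGraph.dist_self]; simp

/-- Matching at the middle of the last edges. -/
lemma match_half (hG : G.Connected) {w' : ℕ → V} {n' : ℕ} {hn' : 1 ≤ n'}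
    {hw' : ∀ i, i < n' → G.Adj (w' i) (w' (i + 1))} {i j : ℕ} (hi : i < n) (hj : j < n')
    (h1 : w i = w' (j + 1)) (h2 : w (i + 1) = w' j) :
    mgDist G (pt w n hn hw (i + 1 / 2)) (pt w' n' hn' hw' (j + 1 / 2)) = 0 := by
  apply le_antisymm _ (mgDist_nonneg hG _ _)
  apply mgDist_le_loc
  right
  rw [pt_val hi (by linarith) (by linarith), pt_val hj (by linarith) (by linarith)]
  refine ⟨h1, h2, ?_⟩
  norm_num

end lower
end MGH

open SimpleGraph Set

set_option linter.unusedSectionVars false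
set_option linter.unusedVariables false

namespace MGH

section lower

variable {V : Type} [Fintype V] [DecidableEq V] {G : SimpleGraph V}

lemma far_vertex (hG : G.Connected) {x : MGPoint G} {u : V} (hx : IsEnd x u 0)
    {w : ℕ → V} {n : ℕ} {hn : 1 ≤ n} {hw : ∀ i, i < n → G.Adj (w i) (w (i + 1))}
    (hu : ∀ i, i ≤ n → w i ≠ u) {t : ℝ} (h0 : 0 ≤ t) (ht : t ≤ n) :
    1 ≤ mgDist G x (pt w n hn hw t) := by
  rw [mgDist_vertex hG hx]
  obtain ⟨i, hi, hi1, hi2, hE⟩ := pt_ends (w := w) (n := n) (hn := hn) (hw := hw) h0 ht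
  obtain ⟨e, s, he, hes⟩ := mgVDist_cases u (pt w n hn hw t)
  rw [hes]
  have hs := he.nonneg
  have hne : e ≠ u := by
    rcases hE.2.2 _ _ he with ⟨rfl, _⟩ | ⟨rfl, _⟩
    · exact hu _ (by omega)
    · exact hu _ (by omega)
  have : 1 ≤ G.dist u e := Nat.one_le_iff_ne_zero.2 (by
    intro h; exact hne ((hG.dist_eq_zero_iff).1 h).symm)
  have : (1 : ℝ) ≤ G.dist u e := by exact_mod_cast this
  linarith

lemma geo_seq (hG : G.Connected) (r u : V) : ∃ w : ℕ → V, w 0 = r ∧ w (G.dist r u) = u ∧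
    (∀ i, i < G.dist r u → G.Adj (w i) (w (i + 1))) ∧ ∀ i, i ≤ G.dist r u → G.dist r (w i) = i := by
  obtain ⟨p, hp⟩ := hG.exists_walk_length_eq_dist r u
  refine ⟨p.getVert, by simp, by rw [← hp]; simp, fun i hi => p.adj_getVert_succ (by omega), ?_⟩
  intro i hi
  have h1 := SimpleGraph.dist_le (p.take i)
  have h2 := SimpleGraph.dist_le (p.drop i)
  have h3 := hG.dist_triangle (u := r) (v := p.getVert i) (w := u)
  rw [Walk.take_length] at h1
  rw [Walk.drop_length] at h2
  omega

lemma ext_seq {w : ℕ → V} {k : ℕ} (hw : ∀ i, i < k → G.Adj (w i) (w (i + 1))) {v : V}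
    (h : G.Adj (w k) v) : ∃ w' : ℕ → V, (∀ i, i ≤ k → w' i = w i) ∧ w' (k + 1) = v ∧
    ∀ i, i < k + 1 → G.Adj (w' i) (w' (i + 1)) := by
  refine ⟨fun i => if i ≤ k then w i else v, fun i hi => by simp [hi], by simp, ?_⟩
  intro i hi
  by_cases h1 : i < k
  · have h2 : i ≤ k := h1.le
    have h3 : i + 1 ≤ k := h1
    simp only [h2, h3, if_true]; exact hw i h1
  · obtain rfl : i = k := by omega
    simpa using h

/-- Two parents. -/
lemma A1 (hG : G.Connected) (hδ : hypDelta G < 1) {r u u' v : V} (h : G.Adj u v) (h' : G.Adj u' v)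
    (hd : G.dist r v = G.dist r u + 1) (hd' : G.dist r v = G.dist r u' + 1) : u = u' := by
  by_contra hne
  apply absurd hδ
  rw [not_lt]
  obtain ⟨w, w0, wu, wa, wd⟩ := geo_seq hG r u
  obtain ⟨w', w0', wu', wa', wd'⟩ := geo_seq hG r u'
  have hk : G.dist r u' = G.dist r u := by omega
  rw [hk] at wu' wa' wd'
  generalize hkk : G.dist r u = k at *
  obtain ⟨y, y1, y2, y3⟩ := ext_seq wa (v := v) (by rw [wu]; exact h)
  obtain ⟨y', y1', y2', y3'⟩ := ext_seq wa' (v := v) (by rw [wu']; exact h')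
  have e0 : y 0 = r := by rw [y1 0 (by omega), w0]
  have e0' : y' 0 = r := by rw [y1' 0 (by omega), w0']
  have hn : 1 ≤ k + 1 := by omega
  apply bigon (w := y) (n := k + 1) (hn := hn) (hw := y3) (w' := y') (n' := k + 1) (hn' := hn)
    (hw' := y3') hG (a := 0) (b := (k + 1 : ℕ)) (s := k) le_rfl (by positivity)
    (by push_cast; linarith) le_rfl le_rfl
  · apply pt_start_lb hG (by linarith) le_rfl
    · intro i hi
      rw [e0, y1 i (by omega), wd i (by omega)]
    · rw [e0, y2, hd]; push_cast; linarith
  · apply pt_start_lb hG (by linarith) le_rfl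
    · intro i hi
      rw [e0', y1' i (by omega), wd' i (by omega)]
    · rw [e0', y2', hd]; push_cast; linarith
  · have a1 := pt_zero_end (w := y) (n := k + 1) (hn := hn) (hw := y3)
    have a2 := pt_zero_end (w := y') (n := k + 1) (hn := hn) (hw := y3')
    rw [e0] at a1; rw [e0'] at a2
    exact match_zero hG a1 a2
  · have a1 := pt_last_end (w := y) (n := k + 1) (hn := hn) (hw := y3)
    have a2 := pt_last_end (w := y') (n := k + 1) (hn := hn) (hw := y3')
    rw [y2] at a1; rw [y2'] at a2
    exact match_zero hG a1 a2
  · intro t ht0 ht1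
    have a1 := pt_nat_end (w := y) (n := k + 1) (hn := hn) (hw := y3) (j := k) (by omega)
    rw [y1 k le_rfl, wu] at a1
    refine far_vertex hG a1 ?_ ht0 ht1
    intro i hi he
    rcases Nat.lt_or_ge i (k + 1) with h1 | h1
    · rw [y1' i (by omega)] at he
      have := wd' i (by omega)
      rw [he, hkk] at this
      subst this
      exact hne (he.symm.trans wu')
    · obtain rfl : i = k + 1 := by omega
      rw [y2'] at he
      rw [he] at hd; omega

/-- Horizontal edge. -/
lemma A2 (hG : G.Connected) (hδ : hypDelta G < 1) {r u v pu pv : V} (huv : G.Adj u v)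
    (h : G.Adj pu u) (h' : G.Adj pv v) (hl : G.dist r u = G.dist r v)
    (hd : G.dist r u = G.dist r pu + 1) (hd' : G.dist r v = G.dist r pv + 1) : pu = pv := by
  by_contra hne
  apply absurd hδ
  rw [not_lt]
  obtain ⟨w, w0, wu, wa, wd⟩ := geo_seq hG r pu
  obtain ⟨w', w0', wu', wa', wd'⟩ := geo_seq hG r pv
  have hk : G.dist r pv = G.dist r pu := by omega
  rw [hk] at wu' wa' wd'
  generalize hkk : G.dist r pu = k at *
  obtain ⟨y, y1, y2, y3⟩ := ext_seq wa (v := u) (by rw [wu]; exact h)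
  obtain ⟨y', y1', y2', y3'⟩ := ext_seq wa' (v := v) (by rw [wu']; exact h')
  obtain ⟨z, z1, z2, z3⟩ := ext_seq y3 (v := v) (by rw [y2]; exact huv)
  obtain ⟨z', z1', z2', z3'⟩ := ext_seq y3' (v := u) (by rw [y2']; exact huv.symm)
  have e0 : z 0 = r := by rw [z1 0 (by omega), y1 0 (by omega), w0]
  have e0' : z' 0 = r := by rw [z1' 0 (by omega), y1' 0 (by omega), w0']
  have ek : z (k + 1) = u := by rw [z1 _ le_rfl, y2]
  have ek' : z' (k + 1) = v := by rw [z1' _ le_rfl, y2']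
  have hn : 1 ≤ k + 1 + 1 := by omega
  have zd : ∀ i, i < k + 1 + 1 → G.dist (z 0) (z i) = i := by
    intro i hi
    rcases Nat.lt_or_ge i (k + 1) with h1 | h1
    · rw [e0, z1 i (by omega), y1 i (by omega), wd i (by omega)]
    · obtain rfl : i = k + 1 := by omega
      rw [e0, ek, hd]
  have zd' : ∀ i, i < k + 1 + 1 → G.dist (z' 0) (z' i) = i := by
    intro i hi
    rcases Nat.lt_or_ge i (k + 1) with h1 | h1
    · rw [e0', z1' i (by omega), y1' i (by omega), wd' i (by omega)]
    · obtain rfl : i = k + 1 := by omega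
      rw [e0', ek', ← hl, hd]
  apply bigon (w := z) (n := k + 1 + 1) (hn := hn) (hw := z3) (w' := z') (n' := k + 1 + 1) (hn' := hn)
    (hw' := z3') hG (a := 0) (b := (k + 1 : ℕ) + 1 / 2) (s := k) le_rfl (by positivity)
    (by push_cast; linarith) (by push_cast; linarith) (by push_cast; linarith)
  · apply pt_start_lb hG (by push_cast; linarith) (by push_cast; linarith) zd
    rw [e0, z2, ← hl, hd]; push_cast; linarith
  · apply pt_start_lb hG (by push_cast; linarith) (by push_cast; linarith) zd'
    rw [e0', z2', hd]; push_cast; linarith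
  · have a1 := pt_zero_end (w := z) (n := k + 1 + 1) (hn := hn) (hw := z3)
    have a2 := pt_zero_end (w := z') (n := k + 1 + 1) (hn := hn) (hw := z3')
    rw [e0] at a1; rw [e0'] at a2
    exact match_zero hG a1 a2
  · exact match_half hG (by omega) (by omega) (by rw [ek, z2']) (by rw [ek', z2])
  · intro t ht0 ht1
    have a1 := pt_nat_end (w := z) (n := k + 1 + 1) (hn := hn) (hw := z3) (j := k) (by omega)
    rw [z1 k (by omega), y1 k le_rfl, wu] at a1
    refine far_vertex hG a1 ?_ ht0 (by push_cast at ht1 ⊢; linarith)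
    intro i hi he
    rcases Nat.lt_or_ge i (k + 1 + 1) with h1 | h1
    · have := zd' i h1
      rw [e0', he, hkk] at this
      subst this
      rw [z1' k (by omega), y1' k le_rfl, wu'] at he
      exact hne he.symm
    · obtain rfl : i = k + 1 + 1 := by omega
      rw [z2'] at he
      rw [he] at hd; omega

/-- No complete graph on four vertices. -/
lemma A4 (hG : G.Connected) {a b c d : V} (hab : G.Adj a b) (hac : G.Adj a c) (had : G.Adj a d)
    (hbc : G.Adj b c) (hbd : G.Adj b d) (hcd : G.Adj c d) : 1 ≤ hypDelta G := by
  have nab := hab.ne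
  have nac := hac.ne
  have nad := had.ne
  have nbc := hbc.ne
  have nbd := hbd.ne
  have ncd := hcd.ne
  let w : ℕ → V := fun i => if i = 0 then b else if i = 1 then a else if i = 2 then d else c
  let w' : ℕ → V := fun i => if i = 0 then a else if i = 1 then b else if i = 2 then c else d
  have hn : 1 ≤ 3 := by omega
  have hw : ∀ i, i < 3 → G.Adj (w i) (w (i + 1)) := by
    intro i hi
    interval_cases i
    · exact hab.symm
    · exact had
    · exact hcd.symm
  have hw' : ∀ i, i < 3 → G.Adj (w' i) (w' (i + 1)) := by
    intro i hi
    interval_cases i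
    · exact hab
    · exact hbc
    · exact hcd
  have V1 := hasEnds_of_val (pt_val (w := w) (n := 3) (hn := hn) (hw := hw) (s := ((0:ℕ):ℝ) + 1 / 2) (i := 0)
    (by norm_num) (by norm_num) (by norm_num)) rfl
  have V2 := hasEnds_of_val (pt_val (w := w) (n := 3) (hn := hn) (hw := hw) (s := ((2:ℕ):ℝ) + 1 / 2) (i := 2)
    (by norm_num) (by norm_num) (by norm_num)) rfl
  have V3 := hasEnds_of_val (pt_val (w := w) (n := 3) (hn := hn) (hw := hw) (s := ((1:ℕ):ℝ) + 1 / 2) (i := 1)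
    (by norm_num) (by norm_num) (by norm_num)) rfl
  have V1' := hasEnds_of_val (pt_val (w := w') (n := 3) (hn := hn) (hw := hw') (s := ((0:ℕ):ℝ) + 1 / 2) (i := 0)
    (by norm_num) (by norm_num) (by norm_num)) rfl
  have V2' := hasEnds_of_val (pt_val (w := w') (n := 3) (hn := hn) (hw := hw') (s := ((2:ℕ):ℝ) + 1 / 2) (i := 2)
    (by norm_num) (by norm_num) (by norm_num)) rfl
  let φ : V → ℝ := fun x => if x = a ∨ x = b then 3 / 2 else 1 / 2
  have hφ : ∀ u v, G.Adj u v → |φ u - φ v| ≤ 1 := by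
    intro u v _
    simp only [φ]; split_ifs <;> norm_num
  let ψ : V → ℝ := fun x => if x = a ∨ x = d then 1 / 2 else 0
  have hψ : ∀ u v, G.Adj u v → |ψ u - ψ v| ≤ 1 := by
    intro u v _
    simp only [ψ]; split_ifs <;> norm_num
  apply bigon (w := w) (n := 3) (hn := hn) (hw := hw) (w' := w') (n' := 3) (hn' := hn)
    (hw' := hw') hG (a := ((0:ℕ):ℝ) + 1 / 2) (b := ((2:ℕ):ℝ) + 1 / 2) (s := ((1:ℕ):ℝ) + 1 / 2)
    (by norm_num) (by norm_num) (by norm_num) (by norm_num) (by norm_num)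
  · apply dist_lb hG hφ V1 V2
    · simp [w, φ]; norm_num
    · simp [w, φ]; norm_num
    · simp [w, φ, nad.symm, nbd.symm]
    · simp [w, φ, nac.symm, nbc.symm]; norm_num
    · left; simp [w, nbd, nbc]
  · apply dist_lb hG hφ V1' V2'
    · simp [w', φ]; norm_num
    · simp [w', φ]; norm_num
    · simp [w', φ, nac.symm, nbc.symm]
    · simp [w', φ, nad.symm, nbd.symm]; norm_num
    · left; simp [w', nac, nad]
  · exact match_half hG (by omega) (by omega) rfl rfl
  · exact match_half hG (by omega) (by omega) rfl rfl
  · intro t ht0 ht1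
    norm_num at ht0 ht1
    obtain ⟨i, hi, hi1, hi2, hE⟩ := pt_ends (w := w') (n := 3) (hn := hn) (hw := hw') (s := t)
      (by linarith) (by norm_num; linarith)
    apply dist_lb hG hψ V3 hE
    · simp [w, ψ]; norm_num
    · simp [w, ψ]
    · interval_cases i
      · simp [w', ψ]; linarith
      · simp [w', ψ, nab.symm, nbd]; simpa using hi1
      · simp [w', ψ, nac.symm, ncd]; simpa using hi1
    · interval_cases i
      · simp [w', ψ, nab.symm, nbd]; simpa using hi2
      · simp [w', ψ, nac.symm, ncd]; norm_num at hi2 ⊢; linarith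
      · simp [w', ψ]; norm_num; linarith
    · interval_cases i
      · right; simp [w, w', nad.symm, nbd.symm]
      · left; simp [w, w', nab, nac]
      · left; simp [w, w', nac, nad]

end lower

end MGH

open SimpleGraph Set

set_option linter.unusedSectionVars false
set_option linter.unusedVariables false

namespace MGH

section lower2

variable {V : Type} [Fintype V] [DecidableEq V] {G : SimpleGraph V}

lemma exists_parent (hG : G.Connected) {r v : V} (h : G.dist r v ≠ 0) :
    ∃ p, G.Adj p v ∧ G.dist r v = G.dist r p + 1 := by
  obtain ⟨w, w0, wu, wa, wd⟩ := geo_seq hG r v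
  obtain ⟨k, hk⟩ := Nat.exists_eq_succ_of_ne_zero h
  rw [hk] at wu wa wd
  refine ⟨w k, ?_, ?_⟩
  · have := wa k (by omega)
    rwa [show k + 1 = Nat.succ k from rfl, wu] at this
  · rw [wd k (by omega), hk]

lemma no_bad_nbrs (hG : G.Connected) (hδ : hypDelta G < 1) {r v x y : V} (hx : G.Adj v x)
    (hy : G.Adj v y) (hxy : x ≠ y) (dx : G.dist r x = G.dist r v) (dy : G.dist r y ≤ G.dist r v) :
    G.dist r v = G.dist r y + 1 ∧ G.Adj y x := by
  have hv0 : G.dist r v ≠ 0 := by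
    intro h0
    have h1 : r = v := (hG.dist_eq_zero_iff).1 h0
    have h2 : r = x := (hG.dist_eq_zero_iff).1 (dx.trans h0)
    exact hx.ne (h1.symm.trans h2)
  obtain ⟨p, hp, dp⟩ := exists_parent hG hv0
  obtain ⟨px, hpx, dpx⟩ := exists_parent hG (r := r) (v := x) (by rw [dx]; exact hv0)
  have e1 : p = px := A2 hG hδ hx hp hpx dx.symm dp dpx
  subst e1
  have ht := hG.dist_triangle (u := r) (v := y) (w := v)
  have hyv : G.dist y v = 1 := dist_eq_one_iff_adj.2 hy.symm
  rcases (show G.dist r v = G.dist r y + 1 ∨ G.dist r y = G.dist r v by omega) with h | h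
  · refine ⟨h, ?_⟩
    have : p = y := A1 hG hδ hp hy.symm dp h
    rw [← this]; exact hpx
  · exfalso
    obtain ⟨py, hpy, dpy⟩ := exists_parent hG (r := r) (v := y) (by rw [h]; exact hv0)
    have e2 : p = py := A2 hG hδ hy hp hpy h.symm dp dpy
    subst e2
    by_cases hxy' : G.Adj x y
    · exact absurd (A4 hG hp hpx hpy hx hy hxy') (by rw [not_le]; exact hδ)
    · have d1 : G.dist x p = 1 := dist_eq_one_iff_adj.2 hpx.symm
      have d2 : G.dist x v = 1 := dist_eq_one_iff_adj.2 hx.symm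
      have d3 : G.dist p y = 1 := dist_eq_one_iff_adj.2 hpy
      have d4 : G.dist x y ≠ 0 := fun h0 => hxy ((hG.dist_eq_zero_iff).1 h0)
      have d5 : G.dist x y ≠ 1 := fun h0 => hxy' (dist_eq_one_iff_adj.1 h0)
      have d6 := hG.dist_triangle (u := x) (v := p) (w := y)
      have := A1 hG hδ (r := x) hpy hy (by omega) (by omega)
      exact hp.ne this

lemma cyc_inj {v : V} {Z : G.Walk v v} (hZ : Z.IsCycle) {i j : ℕ} (hi : i < Z.length)
    (hj : j < Z.length) (h : Z.getVert i = Z.getVert j) : i = j :=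
  hZ.getVert_injOn' (by simp; omega) (by simp; omega) h

/-- A cycle of length at least four forces the hyperbolicity constant to be at least one. -/
theorem one_le_of_cycle (hG : G.Connected) {a : V} (Z : G.Walk a a) (hZ : Z.IsCycle)
    (hl : 4 ≤ Z.length) : 1 ≤ hypDelta G := by
  by_contra hδ
  rw [not_le] at hδ
  obtain ⟨v, hv, hmax⟩ := Z.support.toFinset.exists_max_image (fun x => G.dist a x) ⟨a, by simp⟩
  simp only [List.mem_toFinset] at hv hmax
  obtain ⟨Y, hY, hYl, hYm⟩ : ∃ Y : G.Walk v v, Y.IsCycle ∧ Y.length = Z.length ∧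
      ∀ x ∈ Y.support, G.dist a x ≤ G.dist a v := by
    refine ⟨Z.rotate v hv, hZ.rotate hv, by simp, ?_⟩
    intro x hx
    exact hmax x (by simpa using hx)
  rw [← hYl] at hl
  have hle : ∀ i, G.dist a (Y.getVert i) ≤ G.dist a v := fun i => hYm _ (Y.getVert_mem_support i)
  have hadj : ∀ i, i < Y.length → G.Adj (Y.getVert i) (Y.getVert (i + 1)) :=
    fun i hi => Y.adj_getVert_succ hi
  have g0 : Y.getVert 0 = v := by simp
  have gl : Y.getVert Y.length = v := by simp
  generalize hn : Y.length = n at *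
  obtain ⟨m, rfl⟩ : ∃ m, n = m + 3 := ⟨n - 3, by omega⟩
  have hx : G.Adj v (Y.getVert 1) := by have := hadj 0 (by omega); rwa [g0] at this
  have hy : G.Adj v (Y.getVert (m + 2)) := by
    have := hadj (m + 2) (by omega); rw [show m + 2 + 1 = m + 3 from rfl, gl] at this; exact this.symm
  have inj : ∀ {i j : ℕ}, i < m + 3 → j < m + 3 → Y.getVert i = Y.getVert j → i = j :=
    fun hi hj h => cyc_inj hY (by omega) (by omega) h
  have hxy : Y.getVert 1 ≠ Y.getVert (m + 2) := fun h => by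
    have := inj (by omega) (by omega) h; omega
  have lx := hle 1
  have ly := hle (m + 2)
  have tx := hG.dist_triangle (u := a) (v := Y.getVert 1) (w := v)
  have ty := hG.dist_triangle (u := a) (v := Y.getVert (m + 2)) (w := v)
  have ax : G.dist (Y.getVert 1) v = 1 := dist_eq_one_iff_adj.2 hx.symm
  have ay : G.dist (Y.getVert (m + 2)) v = 1 := dist_eq_one_iff_adj.2 hy.symm
  by_cases h1 : G.dist a (Y.getVert 1) = G.dist a v
  · obtain ⟨q1, q2⟩ := no_bad_nbrs hG hδ hx hy hxy h1 ly
    have hadj1 : G.Adj (Y.getVert 1) (Y.getVert 2) := hadj 1 (by omega)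
    obtain ⟨q3, q4⟩ := no_bad_nbrs hG hδ (r := a) hx.symm hadj1
      (fun h => by
        have := inj (i := 0) (j := 2) (by omega) (by omega) (by rw [g0]; exact h)
        omega) h1.symm (by rw [h1]; exact hle 2)
    have := A1 hG hδ (r := a) q2 hadj1.symm (by omega) (by omega)
    have := inj (by omega) (by omega) this
    omega
  · by_cases h2 : G.dist a (Y.getVert (m + 2)) = G.dist a v
    · obtain ⟨q1, q2⟩ := no_bad_nbrs hG hδ hy hx hxy.symm h2 lx
      have hadj1 : G.Adj (Y.getVert (m + 1)) (Y.getVert (m + 2)) := hadj (m + 1) (by omega)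
      obtain ⟨q3, q4⟩ := no_bad_nbrs hG hδ (r := a) hy.symm hadj1.symm
        (fun h => by
          have := inj (i := 0) (j := m + 1) (by omega) (by omega) (by rw [g0]; exact h)
          omega) h2.symm (by rw [h2]; exact hle (m + 1))
      have := A1 hG hδ (r := a) q2 hadj1 (by omega) (by omega)
      have := inj (by omega) (by omega) this
      omega
    · have := A1 hG hδ (r := a) hx.symm hy.symm (by omega) (by omega)
      exact hxy this

/-- A triangle forces the hyperbolicity constant to be at least `3/4`. -/
theorem three_quarters (hG : G.Connected) {a b c : V} (hab : G.Adj a b) (hac : G.Adj a c)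
    (hbc : G.Adj b c) : 3 / 4 ≤ hypDelta G := by
  have nab := hab.ne
  have nac := hac.ne
  have nbc := hbc.ne
  let w : ℕ → V := fun i => if i = 0 then a else if i = 1 then b else c
  let w' : ℕ → V := fun i => if i = 0 then a else if i = 1 then c else b
  have hn : 1 ≤ 2 := by omega
  have hw : ∀ i, i < 2 → G.Adj (w i) (w (i + 1)) := by
    intro i hi
    interval_cases i
    · exact hab
    · exact hbc
  have hw' : ∀ i, i < 2 → G.Adj (w' i) (w' (i + 1)) := by
    intro i hi
    interval_cases i
    · exact hac
    · exact hbc.symm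
  have V3 := hasEnds_of_val (pt_val (w := w) (n := 2) (hn := hn) (hw := hw) (s := 3 / 4) (i := 0)
    (by norm_num) (by norm_num) (by norm_num)) rfl
  have dab : G.dist a b = 1 := dist_eq_one_iff_adj.2 hab
  have dac : G.dist a c = 1 := dist_eq_one_iff_adj.2 hac
  let ψ : V → ℝ := fun x => if x = b then 1 / 2 else 0
  have hψ : ∀ u v, G.Adj u v → |ψ u - ψ v| ≤ 1 := by
    intro u v _
    simp only [ψ]; split_ifs <;> norm_num
  apply bigon (w := w) (n := 2) (hn := hn) (hw := hw) (w' := w') (n' := 2) (hn' := hn)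
    (hw' := hw') hG (a := 0) (b := ((1:ℕ):ℝ) + 1 / 2) (s := 3 / 4)
    (by norm_num) (by norm_num) (by norm_num) (by norm_num) (by norm_num)
  · apply pt_start_lb hG (by norm_num) (by norm_num)
    · intro i hi
      interval_cases i
      · simp
      · simp [w, dab]
    · simp [w, dac]; norm_num
  · apply pt_start_lb hG (by norm_num) (by norm_num)
    · intro i hi
      interval_cases i
      · simp
      · simp [w', dac]
    · simp [w', dab]; norm_num
  · exact match_zero hG (v := a) pt_zero_end pt_zero_end
  · exact match_half hG (by omega) (by omega) rfl rfl
  · intro t ht0 ht1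
    norm_num at ht1
    obtain ⟨i, hi, hi1, hi2, hE⟩ := pt_ends (w := w') (n := 2) (hn := hn) (hw := hw') (s := t)
      (by linarith) (by norm_num; linarith)
    apply dist_lb hG hψ V3 hE
    · simp [w, ψ, nab]
    · simp [w, ψ]; norm_num
    · interval_cases i
      · simp [w', ψ, nab]; linarith
      · simp [w', ψ, nbc.symm]; simpa using hi1
    · interval_cases i
      · simp [w', ψ, nbc.symm]; simpa using hi2
      · simp [w', ψ]; norm_num; linarith
    · interval_cases i
      · right; simp [w, w', nab.symm, nbc]
      · left; simp [w, w', nab, nac]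

/-- The cycle with a short chord. -/
theorem chord_core (hG : G.Connected) {c : ℕ} (hc : 4 ≤ c) {z : ℕ → V} (hz0 : z c = z 0)
    (inj : ∀ i j, i < c → j < c → z i = z j → i = j) (hadj : ∀ i, i < c → G.Adj (z i) (z (i + 1)))
    (hE : ∀ u v, G.Adj u v → ∃ i j, i < c ∧ j < c ∧ u = z i ∧ v = z j ∧
      (j = i + 1 ∨ i = j + 1 ∨ (i = 0 ∧ j = c - 1) ∨ (i = c - 1 ∧ j = 0) ∨
        (i = 1 ∧ j = c - 1) ∨ (i = c - 1 ∧ j = 1))) :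
    (c : ℝ) / 4 ≤ hypDelta G := by
  classical
  obtain ⟨I, hI⟩ : ∃ I : V → ℕ, ∀ i, i < c → I (z i) = i := by
    refine ⟨fun v => if h : ∃ i, i < c ∧ z i = v then h.choose else 0, ?_⟩
    intro i hi
    have h : ∃ j, j < c ∧ z j = z i := ⟨i, hi, rfl⟩
    simp only [h, dif_pos]
    exact inj _ _ h.choose_spec.1 hi h.choose_spec.2
  obtain ⟨n, hn1, hn2⟩ : ∃ n, c ≤ 2 * n ∧ 2 * n ≤ c + 1 := ⟨(c + 1) / 2, by omega, by omega⟩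
  have hn1r : (c : ℝ) ≤ 2 * n := by exact_mod_cast hn1
  have hn2r : 2 * (n : ℝ) ≤ c + 1 := by exact_mod_cast hn2
  have hcr : (4 : ℝ) ≤ c := by exact_mod_cast hc
  have hn : 1 ≤ n := by omega
  let w : ℕ → V := z
  let w' : ℕ → V := fun i => z (c - i)
  have hw : ∀ i, i < n → G.Adj (w i) (w (i + 1)) := fun i hi => hadj i (by omega)
  have hw' : ∀ i, i < n → G.Adj (w' i) (w' (i + 1)) := by
    intro i hi
    have := hadj (c - (i + 1)) (by omega)
    rw [show c - (i + 1) + 1 = c - i by omega] at this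
    exact this.symm
  have e0' : w' 0 = z 0 := by simp [w', hz0]
  -- distances from the base point
  let f : V → ℝ := fun v => min (I v : ℝ) (c - I v)
  have hf : ∀ u v, G.Adj u v → |f u - f v| ≤ 1 := by
    intro u v h
    obtain ⟨i, j, hi, hj, rfl, rfl, hij⟩ := hE u v h
    simp only [f]
    rw [hI i hi, hI j hj]
    have hir : (i : ℝ) + 1 ≤ c := by exact_mod_cast hi
    have hjr : (j : ℝ) + 1 ≤ c := by exact_mod_cast hj
    have hi0 : (0 : ℝ) ≤ i := by positivity
    have hj0 : (0 : ℝ) ≤ j := by positivity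
    have hcc : ((c - 1 : ℕ) : ℝ) = c - 1 := by rw [Nat.cast_sub (by omega)]; simp
    rw [abs_le]
    rcases hij with h | h | ⟨h, h'⟩ | ⟨h, h'⟩ | ⟨h, h'⟩ | ⟨h, h'⟩ <;> subst h <;>
      (try subst h') <;> push_cast <;> (try rw [hcc]) <;> constructor <;>
      rcases min_cases (_ : ℝ) (_ : ℝ) with ⟨k1, k2⟩ | ⟨k1, k2⟩ <;> rw [k1] <;>
      rcases min_cases (_ : ℝ) (_ : ℝ) with ⟨k3, k4⟩ | ⟨k3, k4⟩ <;> rw [k3] <;> 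
      push_cast at * <;> linarith
  have hf0 : f (z 0) = 0 := by
    simp only [f]; rw [hI 0 (by omega)]; simp
  have hfd : ∀ v, f v ≤ G.dist (z 0) v := by
    intro v
    have := psi_dist hG hf (z 0) v
    rw [hf0, abs_le] at this
    linarith [this.1]
  have hup : ∀ (y : ℕ → V), (∀ i, i < n → G.Adj (y i) (y (i + 1))) → ∀ i, i ≤ n →
      G.dist (y 0) (y i) ≤ i := by
    intro y hy i
    induction i with
    | zero => intro _; simp
    | succ i ih =>
      intro hi
      have h1 := ih (by omega)
      have h2 := hG.dist_triangle (u := y 0) (v := y i) (w := y (i + 1))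
      have h3 : G.dist (y i) (y (i + 1)) = 1 := dist_eq_one_iff_adj.2 (hy i (by omega))
      omega
  have hfw : ∀ i, i ≤ n → f (w i) = min (i : ℝ) (c - i) := by
    intro i hi
    simp only [f, w]; rw [hI i (by omega)]
  have hfw' : ∀ i, i ≤ n → f (w' i) = min (i : ℝ) (c - i) := by
    intro i hi
    rcases Nat.eq_zero_or_pos i with rfl | h0
    · rw [e0', hf0]; simp
    · simp only [f, w']; rw [hI (c - i) (by omega), Nat.cast_sub (by omega), min_comm]
      congr 1; ring
  have hdw : ∀ i, i < n → G.dist (w 0) (w i) = i := by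
    intro i hi
    apply le_antisymm (hup w hw i hi.le)
    have h1 := hfd (w i)
    have hir : (i : ℝ) + 1 ≤ n := by exact_mod_cast hi
    rw [hfw i hi.le, min_eq_left (by linarith)] at h1
    exact_mod_cast h1
  have hdw' : ∀ i, i < n → G.dist (w' 0) (w' i) = i := by
    intro i hi
    apply le_antisymm (hup w' hw' i hi.le)
    have h1 := hfd (w' i)
    have hir : (i : ℝ) + 1 ≤ n := by exact_mod_cast hi
    rw [hfw' i hi.le, min_eq_left (by linarith), ← e0'] at h1
    exact_mod_cast h1
  let ψ : V → ℝ := fun v => max 0 (min (I v : ℝ) (c / 2 - I v))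
  have hψ : ∀ u v, G.Adj u v → |ψ u - ψ v| ≤ 1 := by
    intro u v h
    obtain ⟨i, j, hi, hj, rfl, rfl, hij⟩ := hE u v h
    simp only [ψ]
    rw [hI i hi, hI j hj]
    have hi0 : (0 : ℝ) ≤ i := by positivity
    have hj0 : (0 : ℝ) ≤ j := by positivity
    have hcc : ((c - 1 : ℕ) : ℝ) = c - 1 := by rw [Nat.cast_sub (by omega)]; simp
    have m0 : min ((c : ℝ) - 1) (c / 2 - (c - 1)) ≤ 0 := (min_le_right _ _).trans (by linarith)
    rcases hij with h | h | ⟨h, h'⟩ | ⟨h, h'⟩ | ⟨h, h'⟩ | ⟨h, h'⟩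
    · subst h
      push_cast
      refine (abs_max_sub_max_le_max _ _ _ _).trans (max_le (by simp) ?_)
      refine (abs_min_sub_min_le_max _ _ _ _).trans (max_le ?_ ?_) <;> ring_nf <;> simp
    · subst h
      push_cast
      refine (abs_max_sub_max_le_max _ _ _ _).trans (max_le (by simp) ?_)
      refine (abs_min_sub_min_le_max _ _ _ _).trans (max_le ?_ ?_) <;> ring_nf <;> simp
    · subst h h'
      rw [hcc, max_eq_left m0, max_eq_left (by simp)]; simp
    · subst h h'
      rw [hcc, max_eq_left m0, max_eq_left (by simp)]; simp
    · subst h h'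
      rw [hcc, max_eq_left m0, min_eq_left (by push_cast; linarith)]; simp
    · subst h h'
      rw [hcc, max_eq_left m0, min_eq_left (by push_cast; linarith)]; simp
  apply bigon (w := w) (n := n) (hn := hn) (hw := hw) (w' := w') (n' := n) (hn' := hn)
    (hw' := hw') hG (a := 0) (b := (c : ℝ) / 2) (s := c / 4)
    (by norm_num) (by positivity) (by linarith) (by linarith) (by linarith)
  · apply pt_start_lb hG (by linarith) (by linarith) hdw
    have := hfd (w n)
    rw [hfw n le_rfl, min_eq_right (by linarith)] at this
    refine le_trans ?_ this
    linarith
  · apply pt_start_lb hG (by linarith) (by linarith) hdw'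
    have := hfd (w' n)
    rw [hfw' n le_rfl, min_eq_right (by linarith), ← e0'] at this
    refine le_trans ?_ this
    linarith
  · refine match_zero hG (v := z 0) pt_zero_end ?_
    have := pt_zero_end (w := w') (n := n) (hn := hn) (hw := hw')
    rwa [e0'] at this
  · rcases (show c = 2 * n ∨ c + 1 = 2 * n by omega) with h | h
    · have hb : (c : ℝ) / 2 = n := by rw [h]; push_cast; ring
      rw [hb]
      refine match_zero hG (v := z n) pt_last_end ?_
      have := pt_last_end (w := w') (n := n) (hn := hn) (hw := hw')
      rwa [show w' n = z n from by simp only [w']; congr 1; omega] at this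
    · obtain ⟨k, rfl⟩ : ∃ k, n = k + 1 := ⟨n - 1, by omega⟩
      have hb : (c : ℝ) / 2 = k + 1 / 2 := by
        have : (c : ℝ) + 1 = 2 * (k + 1) := by exact_mod_cast h
        linarith
      rw [hb]
      apply match_half hG (by omega) (by omega)
      · simp only [w, w']; congr 1; omega
      · simp only [w, w']; congr 1; omega
  · intro t ht0 ht1
    obtain ⟨i, hi, hi1, hi2, hE1⟩ := pt_ends (w := w) (n := n) (hn := hn) (hw := hw) (s := c / 4)
      (by positivity) (by linarith)
    obtain ⟨j, hj, hj1, hj2, hE2⟩ := pt_ends (w := w') (n := n) (hn := hn) (hw := hw') (s := t)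
      (by linarith) (by linarith)
    have hi4 : 4 * i ≤ c := by
      have : 4 * (i : ℝ) ≤ c := by linarith
      exact_mod_cast this
    have hi5 : c ≤ 4 * (i + 1) := by
      have : (c : ℝ) ≤ 4 * (i + 1) := by linarith
      exact_mod_cast this
    apply dist_lb hG hψ hE1 hE2
    · simp only [ψ, w]; rw [hI i (by omega)]
      have := le_max_right 0 (min (i : ℝ) (c / 2 - i))
      rw [min_eq_left (by linarith)] at this ⊢
      linarith
    · simp only [ψ, w]; rw [hI (i + 1) (by omega)]
      have := le_max_right 0 (min ((i + 1 : ℕ) : ℝ) (c / 2 - (i + 1 : ℕ)))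
      rw [min_eq_right (by push_cast; linarith)] at this ⊢
      push_cast at this ⊢
      linarith
    · rcases Nat.eq_zero_or_pos j with rfl | h0
      · simp only [ψ]; rw [e0', hI 0 (by omega)]; simp; exact ht0
      · simp only [ψ, w']; rw [hI (c - j) (by omega), Nat.cast_sub (by omega)]
        have : (j : ℝ) + 1 ≤ n := by exact_mod_cast hj
        apply max_le (by linarith)
        apply (min_le_right _ _).trans
        linarith
    · simp only [ψ, w']; rw [hI (c - (j + 1)) (by omega), Nat.cast_sub (by omega)]
      apply max_le (by linarith)
      apply (min_le_right _ _).trans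
      push_cast
      linarith
    · have key : ∀ a b, 1 ≤ a → a < b → b ≤ c → z a ≠ z b := by
        intro a b h1 h2 h3 h4
        rcases Nat.lt_or_ge b c with h5 | h5
        · have := inj _ _ (by omega) h5 h4; omega
        · obtain rfl : b = c := by omega
          rw [hz0] at h4
          have := inj _ _ (by omega) (by omega) h4; omega
      rcases Nat.eq_zero_or_pos i with rfl | h0
      · right
        exact ⟨key _ _ (by omega) (by omega) (by omega), key _ _ (by omega) (by omega) (by omega)⟩
      · left
        exact ⟨key _ _ (by omega) (by omega) (by omega), key _ _ (by omega) (by omega) (by omega)⟩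

end lower2

end MGH

open SimpleGraph Set

set_option linter.unusedSectionVars false
set_option linter.unusedVariables false

namespace MGH

section structural

variable {V : Type} [Fintype V] [DecidableEq V] {G : SimpleGraph V}

lemma circ_attained (h : circumference G ≠ 0) :
    ∃ (a : V) (w : G.Walk a a), w.IsCycle ∧ w.length = circumference G := by
  have hne : {n : ℕ | ∃ (a : V) (w : G.Walk a a), w.IsCycle ∧ w.length = n}.Nonempty := by
    by_contra hn
    rw [Set.not_nonempty_iff_eq_empty] at hn
    apply h
    unfold circumference
    rw [hn]; simp
  exact Nat.sSup_mem hne (circ_bdd G)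

lemma triangle_of_girth (h : G.girth = 3) : ∃ a b c, G.Adj a b ∧ G.Adj a c ∧ G.Adj b c := by
  have hac : ¬ G.IsAcyclic := by
    intro h0
    rw [← girth_eq_zero] at h0; omega
  obtain ⟨a, w, hw, hl⟩ := exists_girth_eq_length.2 hac
  rw [h] at hl
  have h0 := w.adj_getVert_succ (i := 0) (by omega)
  have h1 := w.adj_getVert_succ (i := 1) (by omega)
  have h2 := w.adj_getVert_succ (i := 2) (by omega)
  have e0 : w.getVert 0 = a := by simp
  have e3 : w.getVert (2 + 1) = a := by
    have : w.getVert w.length = a := by simp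
    rwa [← hl] at this
  rw [e0] at h0
  rw [e3] at h2
  exact ⟨a, _, _, h0, h2.symm, h1⟩

lemma mem_edges_getVert {a b : V} (w : G.Walk a b) (e : Sym2 V) (he : e ∈ w.edges) :
    ∃ i, i < w.length ∧ e = s(w.getVert i, w.getVert (i + 1)) := by
  induction w with
  | nil => simp at he
  | cons h p ih =>
    rw [Walk.edges_cons, List.mem_cons] at he
    rcases he with rfl | he
    · exact ⟨0, by simp, by simp⟩
    · obtain ⟨i, hi, rfl⟩ := ih he
      exact ⟨i + 1, by simpa using hi, by simp⟩

lemma cycle_edge_at {x y : V} {Z : G.Walk x x} (hZ : Z.IsCycle) (h : s(x, y) ∈ Z.edges) :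
    y = Z.getVert 1 ∨ y = Z.getVert (Z.length - 1) := by
  obtain ⟨i, hi, he⟩ := mem_edges_getVert Z _ h
  have h3 := hZ.three_le_length
  have e0 : Z.getVert 0 = x := by simp
  rw [Sym2.eq_iff] at he
  rcases he with ⟨h1, h2⟩ | ⟨h1, h2⟩
  · have := cyc_inj hZ (i := 0) (by omega) hi (e0.trans h1)
    subst this
    exact Or.inl h2
  · right
    rcases Nat.lt_or_ge (i + 1) Z.length with h4 | h4
    · have := cyc_inj hZ (i := 0) (by omega) h4 (e0.trans h1)
      omega
    · rw [h2]; congr 1; omega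

/-- With circumference `c`, girth three and `c + 1` edges. -/
theorem chord_lower (hG : G.Connected) {c : ℕ} (hc : 4 ≤ c) (hg : G.girth = 3)
    (hcirc : circumference G = c) (hm : G.edgeSet.ncard = c + 1) : (c : ℝ) / 4 ≤ hypDelta G := by
  classical
  obtain ⟨r, W, hW, hWl⟩ := circ_attained (G := G) (by omega)
  rw [hcirc] at hWl
  obtain ⟨a, b, d, hab, had, hbd⟩ := triangle_of_girth hg
  -- the edges of the cycle
  have hcard : W.edges.toFinset.card = c := by
    rw [List.toFinset_card_of_nodup hW.edges_nodup, Walk.length_edges, hWl]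
  have hsub : (W.edges.toFinset : Set (Sym2 V)) ⊆ G.edgeSet := by
    intro e he
    simp only [List.coe_toFinset, Set.mem_setOf_eq] at he
    exact Walk.edges_subset_edgeSet W he
  -- at most one edge outside
  have huniq : ∀ e ∈ G.edgeSet, ∀ f ∈ G.edgeSet, e ∉ W.edges → f ∉ W.edges → e = f := by
    intro e he f hf he' hf'
    by_contra hne
    have h1 : (insert e (insert f W.edges.toFinset)).card = c + 2 := by
      rw [Finset.card_insert_of_notMem (by simp [hne, he']),
        Finset.card_insert_of_notMem (by simp [hf']), hcard]
    have h2 : ((insert e (insert f W.edges.toFinset) : Finset (Sym2 V)) : Set (Sym2 V)) ⊆ G.edgeSet := by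
      rw [Finset.coe_insert, Finset.coe_insert]
      exact Set.insert_subset he (Set.insert_subset hf hsub)
    have h3 := Set.ncard_le_ncard h2 (Set.toFinite _)
    rw [Set.ncard_coe_finset, h1, hm] at h3
    omega
  -- a vertex of the triangle whose two edges are on the cycle
  obtain ⟨x, y, y', hyy, hxy, hxy'⟩ : ∃ x y y', G.Adj y y' ∧ s(x, y) ∈ W.edges ∧ s(x, y') ∈ W.edges := by
    have n1 := hab.ne
    have n2 := had.ne
    have n3 := hbd.ne
    by_cases h1 : s(a, b) ∈ W.edges
    · by_cases h2 : s(a, d) ∈ W.edges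
      · exact ⟨a, b, d, hbd, h1, h2⟩
      · by_cases h3 : s(b, d) ∈ W.edges
        · exact ⟨b, a, d, had, by rwa [Sym2.eq_swap], h3⟩
        · have := huniq _ (show s(a, d) ∈ G.edgeSet from had) _ (show s(b, d) ∈ G.edgeSet from hbd) h2 h3
          rw [Sym2.eq_iff] at this; tauto
    · by_cases h2 : s(a, d) ∈ W.edges
      · by_cases h3 : s(b, d) ∈ W.edges
        · exact ⟨d, a, b, hab, by rwa [Sym2.eq_swap], by rwa [Sym2.eq_swap]⟩
        · have := huniq _ (show s(a, b) ∈ G.edgeSet from hab) _ (show s(b, d) ∈ G.edgeSet from hbd) h1 h3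
          rw [Sym2.eq_iff] at this; tauto
      · have := huniq _ (show s(a, b) ∈ G.edgeSet from hab) _ (show s(a, d) ∈ G.edgeSet from had) h1 h2
        rw [Sym2.eq_iff] at this; tauto
  have hx : x ∈ W.support := W.fst_mem_support_of_mem_edges hxy
  obtain ⟨Z, hZ, hZl, hZe⟩ : ∃ Z : G.Walk x x, Z.IsCycle ∧ Z.length = c ∧
      ∀ e, e ∈ Z.edges ↔ e ∈ W.edges :=
    ⟨W.rotate x hx, hW.rotate hx, by simp [hWl], fun e => (W.rotate_edges x hx).mem_iff⟩
  have q1 := cycle_edge_at hZ ((hZe _).2 hxy)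
  have q2 := cycle_edge_at hZ ((hZe _).2 hxy')
  rw [hZl] at q1 q2
  have inj : ∀ i j, i < c → j < c → Z.getVert i = Z.getVert j → i = j :=
    fun i j hi hj h => cyc_inj hZ (by omega) (by omega) h
  have hchord : G.Adj (Z.getVert 1) (Z.getVert (c - 1)) := by
    have := hyy.ne
    rcases q1 with q1 | q1 <;> rcases q2 with q2 | q2 <;> rw [q1, q2] at hyy
    · exact absurd rfl hyy.ne
    · exact hyy
    · exact hyy.symm
    · exact absurd rfl hyy.ne
  have hz0 : Z.getVert c = Z.getVert 0 := by
    rw [← hZl]; simp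
  have hZE : ∀ u v, s(u, v) ∈ Z.edges → ∃ i j, i < c ∧ j < c ∧ u = Z.getVert i ∧ v = Z.getVert j ∧
      (j = i + 1 ∨ i = j + 1 ∨ (i = 0 ∧ j = c - 1) ∨ (i = c - 1 ∧ j = 0)) := by
    intro u v h
    obtain ⟨i, hi, he⟩ := mem_edges_getVert Z _ h
    rw [hZl] at hi
    rw [Sym2.eq_iff] at he
    rcases Nat.lt_or_ge (i + 1) c with h4 | h4
    · rcases he with ⟨h1, h2⟩ | ⟨h1, h2⟩
      · exact ⟨i, i + 1, hi, h4, h1, h2, by omega⟩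
      · exact ⟨i + 1, i, h4, hi, h1, h2, by omega⟩
    · obtain rfl : c = i + 1 := by omega
      rw [hz0] at he
      rcases he with ⟨h1, h2⟩ | ⟨h1, h2⟩
      · exact ⟨i, 0, hi, by omega, h1, h2, by omega⟩
      · exact ⟨0, i, by omega, hi, h1, h2, by omega⟩
  have hnotin : s(Z.getVert 1, Z.getVert (c - 1)) ∉ Z.edges := by
    intro h
    obtain ⟨i, j, hi, hj, h1, h2, h3⟩ := hZE _ _ h
    have := inj _ _ (by omega) hi h1
    have := inj _ _ (by omega) hj h2
    omega
  apply chord_core hG hc hz0 inj (fun i hi => Z.adj_getVert_succ (by omega))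
  intro u v huv
  by_cases h : s(u, v) ∈ Z.edges
  · obtain ⟨i, j, hi, hj, h1, h2, h3⟩ := hZE _ _ h
    exact ⟨i, j, hi, hj, h1, h2, by omega⟩
  · have := huniq _ (show s(u, v) ∈ G.edgeSet from huv) _
      (show s(Z.getVert 1, Z.getVert (c - 1)) ∈ G.edgeSet from hchord)
      (fun h' => h ((hZe _).2 h')) (fun h' => hnotin ((hZe _).2 h'))
    rw [Sym2.eq_iff] at this
    rcases this with ⟨h1, h2⟩ | ⟨h1, h2⟩
    · exact ⟨1, c - 1, by omega, by omega, h1, h2, by omega⟩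
    · exact ⟨c - 1, 1, by omega, by omega, h1, h2, by omega⟩

end structural

end MGH

open SimpleGraph Set

set_option linter.unusedSectionVars false
set_option linter.unusedVariables false

namespace MGH

section constr

lemma girth_three {V : Type} [Fintype V] [DecidableEq V] {G : SimpleGraph V} {a b c : V}
    (hab : G.Adj a b) (hac : G.Adj a c) (hbc : G.Adj b c) : G.girth = 3 := by
  let p : G.Walk b a := Walk.cons hbc (Walk.cons hac.symm Walk.nil)
  have hp : p.IsPath := by
    simp [p, Walk.isPath_def, hbc.ne, hab.ne.symm, hac.ne.symm]
  have hcyc := cons_cycle hab p hp (by simp [p])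
  have h1 := girth_le_length hcyc
  have h2 : 3 ≤ G.girth := three_le_girth (fun h => h _ hcyc)
  have h3 : (Walk.cons hab p).length = 3 := by simp [p]
  omega

lemma path_connected {k : ℕ} (hk : 0 < k) {G : SimpleGraph (Fin k)}
    (hp : ∀ u v : Fin k, u.val + 1 = v.val → G.Adj u v) : G.Connected := by
  have : Nonempty (Fin k) := ⟨⟨0, hk⟩⟩
  have key : ∀ i (hi : i < k), G.Reachable ⟨0, hk⟩ ⟨i, hi⟩ := by
    intro i
    induction i with
    | zero => intro _; rfl
    | succ i ih => intro hi; exact (ih (by omega)).trans (hp _ _ rfl).reachable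
  exact ⟨fun u v => (key u u.2).symm.trans (key v v.2)⟩

lemma path_dist_aux {k : ℕ} {G : SimpleGraph (Fin k)} (hG : G.Connected)
    (hp : ∀ u v : Fin k, u.val + 1 = v.val → G.Adj u v) (d : ℕ) (u v : Fin k)
    (h : u.val + d = v.val) : G.dist u v ≤ d := by
  induction d generalizing v with
  | zero =>
    have : u = v := Fin.ext (by omega)
    subst this; simp
  | succ d ih =>
    have h1 := ih ⟨u.val + d, by omega⟩ rfl
    have h2 := hG.dist_triangle (u := u) (v := ⟨u.val + d, by omega⟩) (w := v)
    have h3 : G.dist ⟨u.val + d, by omega⟩ v = 1 := dist_eq_one_iff_adj.2 (hp _ _ (by simp; omega))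
    omega

lemma path_dist {k : ℕ} {G : SimpleGraph (Fin k)} (hG : G.Connected)
    (hp : ∀ u v : Fin k, u.val + 1 = v.val → G.Adj u v) (u v : Fin k) :
    (G.dist u v : ℤ) ≤ |(u.val : ℤ) - v.val| := by
  rcases Nat.le_total u.val v.val with h | h
  · have := path_dist_aux hG hp (v.val - u.val) u v (by omega)
    rw [abs_of_nonpos (by omega)]; omega
  · have := path_dist_aux hG hp (u.val - v.val) v u (by omega)
    rw [SimpleGraph.dist_comm, abs_of_nonneg (by omega)]; omega

/-- Cycles avoid the tail. -/
lemma cycle_core {k c : ℕ} {G : SimpleGraph (Fin k)}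
    (ht : ∀ u v : Fin k, G.Adj u v → c ≤ u.val → v.val = u.val + 1 ∨ v.val + 1 = u.val)
    {a : Fin k} (Z : G.Walk a a) (hZ : Z.IsCycle) : ∀ x ∈ Z.support, x.val < c := by
  obtain ⟨v, hv, hmax⟩ := Z.support.toFinset.exists_max_image (fun x => x.val) ⟨a, by simp⟩
  simp only [List.mem_toFinset] at hv hmax
  suffices h : v.val < c from fun x hx => (hmax x hx).trans_lt h
  by_contra hvc
  obtain ⟨Y, hY, hYl, hYm⟩ : ∃ Y : G.Walk v v, Y.IsCycle ∧ Y.length = Z.length ∧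
      ∀ x ∈ Y.support, x.val ≤ v.val := by
    refine ⟨Z.rotate v hv, hZ.rotate hv, by simp, ?_⟩
    intro x hx
    exact hmax x (by simpa using hx)
  have h3 := hY.three_le_length
  have a1 := Y.adj_getVert_succ (i := 0) (by omega)
  have a2 := Y.adj_getVert_succ (i := Y.length - 1) (by omega)
  rw [show Y.length - 1 + 1 = Y.length by omega, Y.getVert_length] at a2
  rw [Y.getVert_zero] at a1
  have b1 := ht _ _ a1 (by omega)
  have b2 := ht _ _ a2.symm (by omega)
  have c1 := hYm _ (Y.getVert_mem_support (0 + 1))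
  have c2 := hYm _ (Y.getVert_mem_support (Y.length - 1))
  have : Y.getVert (0 + 1) = Y.getVert (Y.length - 1) := Fin.ext (by omega)
  have := cyc_inj hY (by omega) (by omega) this
  omega

lemma core_class {k c : ℕ} (hc : 3 ≤ c) (hck : c ≤ k) {G : SimpleGraph (Fin k)}
    (hp : ∀ u v : Fin k, u.val + 1 = v.val → G.Adj u v)
    (hcl : G.Adj ⟨0, by omega⟩ ⟨c - 1, by omega⟩)
    (ht : ∀ u v : Fin k, G.Adj u v → c ≤ u.val → v.val = u.val + 1 ∨ v.val + 1 = u.val) :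
    circumference G = c := by
  apply le_antisymm
  · apply csSup_le'
    rintro m ⟨a, Z, hZ, rfl⟩
    have h1 := hZ.support_nodup
    have h2 : Z.support.tail.length = Z.length := by simp
    rw [← h2, ← List.toFinset_card_of_nodup h1]
    have h3 : Z.support.tail.toFinset.image (fun x => x.val) ⊆ Finset.range c := by
      intro i hi
      simp only [Finset.mem_image, List.mem_toFinset] at hi
      obtain ⟨x, hx, rfl⟩ := hi
      rw [Finset.mem_range]
      exact cycle_core ht Z hZ x (List.mem_of_mem_tail hx)
    have h4 := Finset.card_le_card h3
    rwa [Finset.card_image_of_injective _ Fin.val_injective, Finset.card_range] at h4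
  · let z : ℕ → Fin k := fun i => if h : i < k then ⟨i, h⟩ else ⟨0, by omega⟩
    have hz : ∀ i, i < k → (z i).val = i := fun i hi => by simp [z, hi]
    obtain ⟨w, hl, -, hpath⟩ := seqWalk (G := G) z 0 (c - 1) (fun i _ hi => hp _ _ (by
      rw [hz i (by omega), hz (i + 1) (by omega)]))
    have hw := hpath (fun i j _ h1 h2 h3 => by
      have := congrArg Fin.val h3
      rw [hz i (by omega), hz j (by omega)] at this
      omega)
    have hcl' : G.Adj (z (0 + (c - 1))) (z 0) := by
      have e1 : z (0 + (c - 1)) = ⟨c - 1, by omega⟩ := Fin.ext (by rw [hz _ (by omega)]; simp)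
      have e2 : z 0 = ⟨0, by omega⟩ := Fin.ext (by rw [hz _ (by omega)])
      rw [e1, e2]; exact hcl.symm
    have hcyc := cons_cycle hcl' w hw (by omega)
    have := cycle_le_circ _ hcyc
    rw [Walk.length_cons, hl] at this
    omega

/-- Counting edges. -/
lemma edge_count {k : ℕ} {G : SimpleGraph (Fin k)} (S : Finset (ℕ × ℕ))
    (hS : ∀ p ∈ S, p.1 < p.2 ∧ p.2 < k)
    (hA : ∀ u v : Fin k, u.val < v.val → (G.Adj u v ↔ (u.val, v.val) ∈ S)) :
    G.edgeSet.ncard = S.card := by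
  rw [← Set.ncard_coe_finset]
  symm
  apply Set.ncard_congr (fun p hp => s((⟨p.1, (hS p hp).1.trans (hS p hp).2⟩ : Fin k), ⟨p.2, (hS p hp).2⟩))
  · intro p hp
    exact (hA _ _ (hS p hp).1).2 hp
  · intro p q hp hq h
    rw [Sym2.eq_iff] at h
    have h1 := (hS p hp).1
    have h2 := (hS q hq).1
    simp only [Fin.mk.injEq] at h
    ext <;> omega
  · intro e he
    induction e using Sym2.ind with
    | _ u v =>
      have hadj : G.Adj u v := he
      rcases Nat.lt_trichotomy u.val v.val with h | h | h
      · exact ⟨(u.val, v.val), (hA u v h).1 hadj, rfl⟩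
      · exact absurd (Fin.ext h) hadj.ne
      · exact ⟨(v.val, u.val), (hA v u h).1 hadj.symm, Sym2.eq_swap⟩

/-- The graph given by a list of pairs. -/
def gr (k : ℕ) (S : Finset (ℕ × ℕ)) : SimpleGraph (Fin k) :=
  SimpleGraph.fromRel (fun u v => (u.val, v.val) ∈ S)

lemma gr_adj {k : ℕ} {S : Finset (ℕ × ℕ)} (hS : ∀ p ∈ S, p.1 < p.2 ∧ p.2 < k) (u v : Fin k) :
    (gr k S).Adj u v ↔ ((u.val, v.val) ∈ S ∨ (v.val, u.val) ∈ S) := by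
  unfold gr
  rw [SimpleGraph.fromRel_adj]
  constructor
  · exact fun h => h.2
  · intro h
    refine ⟨?_, h⟩
    rintro rfl
    rcases h with h | h <;> exact absurd (hS _ h).1 (lt_irrefl _)

lemma gr_count {k : ℕ} {S : Finset (ℕ × ℕ)} (hS : ∀ p ∈ S, p.1 < p.2 ∧ p.2 < k) :
    (gr k S).edgeSet.ncard = S.card := by
  apply edge_count S hS
  intro u v huv
  rw [gr_adj hS]
  constructor
  · rintro (h | h)
    · exact h
    · have := (hS _ h).1; simp only at this; omega
  · exact Or.inl

/-- Complete graph with a tail. -/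
theorem exists_complete (c n : ℕ) (hc : 4 ≤ c) :
    ∃ (k : ℕ) (G : SimpleGraph (Fin k)), memHclass 3 c (c * (c - 1) / 2 + n) G ∧ hypDelta G ≤ 1 := by
  let S1 : Finset (ℕ × ℕ) := (Finset.range c ×ˢ Finset.range c).filter (fun p => p.1 < p.2)
  let S2 : Finset (ℕ × ℕ) := (Finset.range n).image (fun j => (c - 1 + j, c + j))
  have m1 : ∀ a b, (a, b) ∈ S1 ↔ a < b ∧ b < c := by
    intro a b; simp only [S1, Finset.mem_filter, Finset.mem_product, Finset.mem_range]; omega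
  have m2 : ∀ a b, (a, b) ∈ S2 ↔ a + 1 = b ∧ c ≤ b ∧ b < c + n := by
    intro a b; simp only [S2, Finset.mem_image, Finset.mem_range, Prod.mk.injEq]
    constructor
    · rintro ⟨j, h1, h2, h3⟩; omega
    · rintro ⟨h1, h2, h3⟩; exact ⟨b - c, by omega, by omega, by omega⟩
  have m : ∀ a b, (a, b) ∈ S1 ∪ S2 ↔ (a < b ∧ b < c) ∨ (a + 1 = b ∧ c ≤ b ∧ b < c + n) := by
    intro a b; rw [Finset.mem_union, m1, m2]
  have hS : ∀ p ∈ S1 ∪ S2, p.1 < p.2 ∧ p.2 < c + n := by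
    rintro ⟨a, b⟩ h
    rw [m] at h
    simp only; omega
  have hS1 : ∀ p ∈ S1, p.1 < p.2 ∧ p.2 < c := by
    rintro ⟨a, b⟩ h
    rw [m1] at h
    simp only; omega
  have c1 : S1.card = c * (c - 1) / 2 := by
    rw [← edge_count (k := c) (G := ⊤) S1 hS1, ← Nat.choose_two_right]
    · have := card_edgeFinset_top_eq_card_choose_two (V := Fin c)
      rw [Fintype.card_fin] at this
      rw [← this, ← Set.ncard_coe_finset]
      simp
    · intro u v huv
      rw [m1]
      simp only [top_adj]
      have : u ≠ v := fun h => by subst h; omega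
      simp [this]; omega
  have c2 : S2.card = n := by
    rw [Finset.card_image_of_injective, Finset.card_range]
    intro i j h
    simp only [Prod.mk.injEq] at h; omega
  have hdisj : Disjoint S1 S2 := by
    rw [Finset.disjoint_left]
    rintro ⟨a, b⟩ h1 h2
    rw [m1] at h1; rw [m2] at h2; omega
  have hadj : ∀ u v : Fin (c + n), (gr (c + n) (S1 ∪ S2)).Adj u v ↔
      (((u.val < v.val ∧ v.val < c) ∨ (u.val + 1 = v.val ∧ c ≤ v.val ∧ v.val < c + n)) ∨
      ((v.val < u.val ∧ u.val < c) ∨ (v.val + 1 = u.val ∧ c ≤ u.val ∧ u.val < c + n))) := by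
    intro u v
    rw [gr_adj hS, m, m]
  have hp : ∀ u v : Fin (c + n), u.val + 1 = v.val → (gr (c + n) (S1 ∪ S2)).Adj u v := by
    intro u v h; rw [hadj]; omega
  have ht : ∀ u v : Fin (c + n), (gr (c + n) (S1 ∪ S2)).Adj u v → c ≤ u.val →
      v.val = u.val + 1 ∨ v.val + 1 = u.val := by
    intro u v h hu; rw [hadj] at h; omega
  have hG : (gr (c + n) (S1 ∪ S2)).Connected := path_connected (by omega) hp
  refine ⟨c + n, gr (c + n) (S1 ∪ S2), ⟨hG, ?_, ?_, ?_⟩, ?_⟩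
  · apply girth_three (a := ⟨0, by omega⟩) (b := ⟨1, by omega⟩) (c := ⟨2, by omega⟩) <;>
      rw [hadj] <;> simp only <;> omega
  · apply core_class (by omega) (by omega) hp _ ht
    rw [hadj]; simp only; omega
  · rw [gr_count hS, Finset.card_union_of_disjoint hdisj, c1, c2]
  · apply hypDelta_le hG (by norm_num)
    apply thmC hG (by norm_num)
    rintro ⟨a, Z, hZ, a0, ha0, a1, ha1, b0, hb0, b1, hb1, hlt, -⟩
    have key : ∀ x ∈ Z.support, ∀ y ∈ Z.support, (gr (c + n) (S1 ∪ S2)).dist x y ≤ 1 := by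
      intro x hx y hy
      have hx' := cycle_core ht Z hZ x hx
      have hy' := cycle_core ht Z hZ y hy
      by_cases hxy : x = y
      · subst hxy; simp
      · have : (gr (c + n) (S1 ∪ S2)).Adj x y := by
          have : x.val ≠ y.val := fun h => hxy (Fin.ext h)
          rw [hadj]; omega
        rw [dist_eq_one_iff_adj.2 this]
    have k1 : ((gr (c + n) (S1 ∪ S2)).dist a0 b0 : ℝ) ≤ 1 := by exact_mod_cast key _ ha0 _ hb0
    have k2 : ((gr (c + n) (S1 ∪ S2)).dist a1 b1 : ℝ) ≤ 1 := by exact_mod_cast key _ ha1 _ hb1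
    linarith

/-- Ladder with a tail. -/
theorem exists_ladder (c n u l : ℕ) (hc : 4 ≤ c) (hu : 1 ≤ u) (huN : u ≤ (c - 2) / 2)
    (hl : (c - 2) / 2 ≤ u * l) :
    ∃ (k : ℕ) (G : SimpleGraph (Fin k)), memHclass 3 c (c + u + n) G ∧
      hypDelta G ≤ 1 + (l : ℝ) / 2 := by
  generalize hN : (c - 2) / 2 = N at *
  have hN1 : 2 * N + 2 ≤ c := by omega
  have hN2 : c ≤ 2 * N + 3 := by omega
  have hl1 : 1 ≤ l := by
    rcases Nat.eq_zero_or_pos l with rfl | h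
    · simp at hl; omega
    · exact h
  obtain ⟨σ, hσ0, hσu, hσmono, hσgap⟩ : ∃ σ : ℕ → ℕ, σ 0 = 0 ∧ σ u = N ∧ (∀ j, σ j < σ (j + 1)) ∧
      ∀ j, σ (j + 1) ≤ σ j + l := by
    refine ⟨fun j => j * N / u, by simp, Nat.mul_div_cancel_left _ (by omega), ?_, ?_⟩
    · intro j
      have : (j * N + u) / u ≤ ((j + 1) * N) / u := Nat.div_le_div_right (by rw [Nat.succ_mul]; omega)
      rw [Nat.add_div_right _ (by omega)] at this
      simp only; omega
    · intro j
      have : ((j + 1) * N) / u ≤ (j * N + u * l) / u :=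
        Nat.div_le_div_right (by rw [Nat.succ_mul]; omega)
      rw [Nat.add_mul_div_left _ _ (by omega)] at this
      exact this
  have hσm : StrictMono σ := strictMono_nat_of_lt_succ hσmono
  have hσlt : ∀ j, j < u → σ j < N := fun j hj => by rw [← hσu]; exact hσm hj
  let S1 : Finset (ℕ × ℕ) := (Finset.range (c + n - 1)).image (fun i => (i, i + 1))
  let S2 : Finset (ℕ × ℕ) := {(0, c - 1)}
  let S3 : Finset (ℕ × ℕ) := (Finset.range u).image (fun j => (σ j, c - 2 - σ j))
  have m1 : ∀ a b, (a, b) ∈ S1 ↔ a + 1 = b ∧ b < c + n := by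
    intro a b; simp only [S1, Finset.mem_image, Finset.mem_range, Prod.mk.injEq]
    constructor
    · rintro ⟨j, h1, h2, h3⟩; omega
    · rintro ⟨h1, h2⟩; exact ⟨a, by omega, by omega, by omega⟩
  have m2 : ∀ a b, (a, b) ∈ S2 ↔ a = 0 ∧ b = c - 1 := by
    intro a b; simp [S2]
  have m3 : ∀ a b, (a, b) ∈ S3 ↔ ∃ j, j < u ∧ σ j = a ∧ c - 2 - σ j = b := by
    intro a b; simp only [S3, Finset.mem_image, Finset.mem_range, Prod.mk.injEq]
  have m : ∀ a b, (a, b) ∈ S1 ∪ S2 ∪ S3 ↔ ((a + 1 = b ∧ b < c + n) ∨ (a = 0 ∧ b = c - 1)) ∨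
      ∃ j, j < u ∧ σ j = a ∧ c - 2 - σ j = b := by
    intro a b; rw [Finset.mem_union, Finset.mem_union, m1, m2, m3]
  have m' : ∀ a b, (a, b) ∈ S1 ∪ S2 ∪ S3 → (a + 1 = b ∧ b < c + n) ∨ (a = 0 ∧ b = c - 1) ∨
      (a < N ∧ a + b = c - 2) := by
    intro a b h
    rw [m] at h
    rcases h with (h | h) | ⟨j, h1, h2, h3⟩
    · exact Or.inl h
    · exact Or.inr (Or.inl h)
    · have := hσlt j h1
      right; right; omega
  have hS : ∀ p ∈ S1 ∪ S2 ∪ S3, p.1 < p.2 ∧ p.2 < c + n := by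
    rintro ⟨a, b⟩ h
    have := m' a b h
    simp only; omega
  have c1 : S1.card = c + n - 1 := by
    rw [Finset.card_image_of_injective, Finset.card_range]
    intro i j h
    simp only [Prod.mk.injEq] at h; omega
  have c3 : S3.card = u := by
    rw [Finset.card_image_of_injective, Finset.card_range]
    intro i j h
    simp only [Prod.mk.injEq] at h
    exact hσm.injective h.1
  have d1 : Disjoint S1 S2 := by
    rw [Finset.disjoint_left]
    rintro ⟨a, b⟩ h1 h2
    rw [m1] at h1; rw [m2] at h2; omega
  have d2 : Disjoint (S1 ∪ S2) S3 := by
    rw [Finset.disjoint_left]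
    rintro ⟨a, b⟩ h1 h2
    rw [Finset.mem_union, m1, m2] at h1; rw [m3] at h2
    obtain ⟨j, h3, h4, h5⟩ := h2
    have := hσlt j h3
    omega
  generalize hGdef : gr (c + n) (S1 ∪ S2 ∪ S3) = G
  have hadj : ∀ u v : Fin (c + n), G.Adj u v ↔
      ((u.val, v.val) ∈ S1 ∪ S2 ∪ S3 ∨ (v.val, u.val) ∈ S1 ∪ S2 ∪ S3) := by
    intro u v
    rw [← hGdef, gr_adj hS]
  have hadj' : ∀ u v : Fin (c + n), G.Adj u v →
      ((u.val + 1 = v.val) ∨ (u.val = 0 ∧ v.val = c - 1) ∨ (u.val < N ∧ u.val + v.val = c - 2)) ∨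
      ((v.val + 1 = u.val) ∨ (v.val = 0 ∧ u.val = c - 1) ∨ (v.val < N ∧ u.val + v.val = c - 2)) := by
    intro u v h
    rw [hadj] at h
    rcases h with h | h
    · have := m' _ _ h; omega
    · have := m' _ _ h; omega
  have hp : ∀ u v : Fin (c + n), u.val + 1 = v.val → G.Adj u v := by
    intro u v h; rw [hadj, m]; left; left; left; omega
  have hcl : G.Adj ⟨0, by omega⟩ ⟨c - 1, by omega⟩ := by
    rw [hadj, m]; left; left; right; simp
  have ht : ∀ u v : Fin (c + n), G.Adj u v → c ≤ u.val →
      v.val = u.val + 1 ∨ v.val + 1 = u.val := by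
    intro u v h hu
    have := hadj' u v h; omega
  have hG : G.Connected := path_connected (by omega) hp
  have hpd := path_dist hG hp
  refine ⟨c + n, G, ⟨hG, ?_, ?_, ?_⟩, ?_⟩
  · apply girth_three (a := ⟨0, by omega⟩) (b := ⟨c - 2, by omega⟩) (c := ⟨c - 1, by omega⟩)
    · rw [hadj, m]; left; right
      exact ⟨0, by omega, hσ0, by rw [hσ0]; simp⟩
    · exact hcl
    · apply hp; simp only; omega
  · exact core_class (by omega) (by omega) hp hcl ht
  · rw [← hGdef, gr_count hS, Finset.card_union_of_disjoint d2, Finset.card_union_of_disjoint d1, c1, c3]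
    simp only [S2, Finset.card_singleton]; omega
  · let h : Fin (c + n) → ℤ := fun v => min ((v.val : ℤ) + 1) (c - 1 - v.val)
    have hh1 : ∀ v : Fin (c + n), 2 * v.val + 2 ≤ c → h v = v.val + 1 := by
      intro v hv; simp only [h]; rw [min_eq_left (by omega)]
    have hh2 : ∀ v : Fin (c + n), ¬ 2 * v.val + 2 ≤ c → h v = c - 1 - v.val := by
      intro v hv; simp only [h]; rw [min_eq_right (by omega)]
    apply ladder_bound hG (h := h) _ (fun v => 2 * v.val + 2 ≤ c) _
      ({ρ | -(n : ℤ) ≤ ρ ∧ ρ ≤ 0} ∪ {ρ | ∃ j, j ≤ u ∧ ρ = σ j + 1}) l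
    · rintro ρ (⟨h1, h2⟩ | ⟨j, hj, rfl⟩)
      · obtain ⟨t, rfl⟩ : ∃ t : ℕ, ρ = -t := ⟨ρ.natAbs, by omega⟩
        refine ⟨⟨c - 1 + t, by omega⟩, ⟨c - 1 + t, by omega⟩, by simp, ?_, ?_⟩
        · intro v hv
          rw [hh1 v hv]
          have e1 := hpd v ⟨0, by omega⟩
          have e2 := hpd ⟨c - 1, by omega⟩ ⟨c - 1 + t, by omega⟩
          have e3 : G.dist ⟨0, by omega⟩ ⟨c - 1, by omega⟩ = 1 := dist_eq_one_iff_adj.2 hcl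
          have e4 := hG.dist_triangle (u := v) (v := ⟨0, by omega⟩) (w := ⟨c - 1 + t, by omega⟩)
          have e5 := hG.dist_triangle (u := ⟨0, by omega⟩) (v := ⟨c - 1, by omega⟩) (w := ⟨c - 1 + t, by omega⟩)
          simp only at e1 e2
          rw [abs_of_nonneg (by omega)] at e1
          rw [abs_of_nonpos (by omega)] at e2
          rw [abs_of_nonneg (by omega)]
          omega
        · intro v hv
          rw [hh2 v hv]
          refine (hpd _ _).trans (le_of_eq ?_)
          rw [← abs_neg]
          congr 1
          simp only; omega
      · have hjN : σ j ≤ N := by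
          rcases Nat.eq_or_lt_of_le hj with rfl | h
          · exact hσu.le
          · exact (hσlt j h).le
        refine ⟨⟨σ j, by omega⟩, ⟨c - 2 - σ j, by omega⟩, ?_, ?_, ?_⟩
        · rcases Nat.eq_or_lt_of_le hj with rfl | h
          · have := hpd ⟨σ j, by omega⟩ ⟨c - 2 - σ j, by omega⟩
            simp only at this
            rw [abs_of_nonpos (by omega)] at this
            omega
          · apply le_of_eq
            apply dist_eq_one_iff_adj.2
            rw [hadj, m]; left; right
            exact ⟨j, h, rfl, rfl⟩
        · intro v hv
          rw [hh1 v hv]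
          refine (hpd _ _).trans (le_of_eq ?_)
          congr 1
          simp only; omega
        · intro v hv
          rw [hh2 v hv]
          refine (hpd _ _).trans (le_of_eq ?_)
          rw [← abs_neg]
          congr 1
          simp only; omega
    · intro a b hab hle
      have hdiff : h b ≤ h a + 1 := by
        have := hadj' a b hab
        by_cases ha : 2 * a.val + 2 ≤ c
        · by_cases hb : 2 * b.val + 2 ≤ c
          · rw [hh1 a ha, hh1 b hb] at *; omega
          · rw [hh1 a ha, hh2 b hb] at *; omega
        · by_cases hb : 2 * b.val + 2 ≤ c
          · rw [hh2 a ha, hh1 b hb] at *; omega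
          · rw [hh2 a ha, hh2 b hb] at *; omega
      have hub : ∀ v, h v ≤ N + 1 := by
        intro v
        by_cases hv : 2 * v.val + 2 ≤ c
        · rw [hh1 v hv]; omega
        · rw [hh2 v hv]; omega
      have hlb : ∀ v, -(n : ℤ) ≤ h v := by
        intro v
        have := v.2
        by_cases hv : 2 * v.val + 2 ≤ c
        · rw [hh1 v hv]; omega
        · rw [hh2 v hv]; omega
      have ha1 := hub a
      have hb1 := hub b
      have ha2 := hlb a
      have hb2 := hlb b
      generalize h a = x at *
      generalize h b = y at *
      by_cases hy : y ≤ 0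
      · exact ⟨x, Or.inl ⟨ha2, by omega⟩, y, Or.inl ⟨hb2, hy⟩, le_rfl, le_rfl, by omega⟩
      · by_cases hx : x ≤ 0
        · exact ⟨0, Or.inl ⟨by omega, le_rfl⟩, 1, Or.inr ⟨0, by omega, by rw [hσ0]; simp⟩,
            by omega, by omega, by omega⟩
        · by_cases hxN : x = N + 1
          · exact ⟨N + 1, Or.inr ⟨u, le_rfl, by rw [hσu]⟩, N + 1, Or.inr ⟨u, le_rfl, by rw [hσu]⟩,
              by omega, by omega, by omega⟩
          · have hex : ∃ j, x ≤ σ j := ⟨u, by rw [hσu]; omega⟩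
            have hspec := Nat.find_spec hex
            have hmin : ∀ i, i < Nat.find hex → ¬ x ≤ σ i := fun i hi => Nat.find_min hex hi
            have hleu : Nat.find hex ≤ u := Nat.find_min' hex (by rw [hσu]; omega)
            generalize Nat.find hex = j0 at *
            have hj0 : j0 ≠ 0 := by
              rintro rfl; rw [hσ0] at hspec; simp at hspec; omega
            obtain ⟨j, rfl⟩ := Nat.exists_eq_succ_of_ne_zero hj0
            have := hmin j (by omega)
            have hg := hσgap j
            rw [show j.succ = j + 1 from rfl] at *
            exact ⟨σ j + 1, Or.inr ⟨j, by omega, rfl⟩, σ (j + 1) + 1, Or.inr ⟨j + 1, hleu, rfl⟩,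
              by omega, by omega, by omega⟩
    · intro a b hab
      have := hadj' a b hab
      rw [abs_le]
      by_cases ha : 2 * a.val + 2 ≤ c
      · by_cases hb : 2 * b.val + 2 ≤ c
        · rw [hh1 a ha, hh1 b hb]; omega
        · rw [hh1 a ha, hh2 b hb]; omega
      · by_cases hb : 2 * b.val + 2 ≤ c
        · rw [hh2 a ha, hh1 b hb]; omega
        · rw [hh2 a ha, hh2 b hb]; omega
    · intro a b hab heq
      have := hadj' a b hab
      by_cases ha : 2 * a.val + 2 ≤ c
      · by_cases hb : 2 * b.val + 2 ≤ c
        · rw [hh1 a ha, hh1 b hb] at heq; omega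
        · simp [ha, hb]
      · by_cases hb : 2 * b.val + 2 ≤ c
        · simp [ha, hb]
        · rw [hh2 a ha, hh2 b hb] at heq; omega

end constr

end MGH

open SimpleGraph Set

set_option linter.unusedSectionVars false
set_option linter.unusedVariables false

namespace MGH

lemma alpha_bdd (g c m : ℕ) : BddBelow {d : ℝ | ∃ (k : ℕ) (G : SimpleGraph (Fin k)),
    memHclass g c m G ∧ d = hypDelta G} := by
  refine ⟨0, ?_⟩
  rintro d ⟨k, G, hG, rfl⟩
  exact hypDelta_nonneg

lemma alpha_le {g c m k : ℕ} {G : SimpleGraph (Fin k)} (h : memHclass g c m G) {B : ℝ}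
    (hB : hypDelta G ≤ B) : alphagcm g c m ≤ B :=
  (csInf_le (alpha_bdd g c m) ⟨k, G, h, rfl⟩).trans hB

lemma le_alpha {g c m : ℕ} (hadm : ∃ (k : ℕ) (G : SimpleGraph (Fin k)), memHclass g c m G) {B : ℝ}
    (h : ∀ (k : ℕ) (G : SimpleGraph (Fin k)), memHclass g c m G → B ≤ hypDelta G) :
    B ≤ alphagcm g c m := by
  obtain ⟨k, G, hG⟩ := hadm
  unfold alphagcm
  refine le_csInf ⟨hypDelta G, k, G, hG, rfl⟩ ?_
  rintro d ⟨k, G, hG, rfl⟩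
  exact h k G hG

lemma alpha_beta_eq {g c m : ℕ} (hadm : ∃ (k : ℕ) (G : SimpleGraph (Fin k)), memHclass g c m G) {B : ℝ}
    (h : ∀ (k : ℕ) (G : SimpleGraph (Fin k)), memHclass g c m G → hypDelta G = B) :
    alphagcm g c m = B ∧ betagcm g c m = B := by
  have : {d : ℝ | ∃ (k : ℕ) (G : SimpleGraph (Fin k)), memHclass g c m G ∧ d = hypDelta G} = {B} := by
    ext d
    simp only [Set.mem_setOf_eq, Set.mem_singleton_iff]
    constructor
    · rintro ⟨k, G, hG, rfl⟩; exact h k G hG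
    · rintro rfl
      obtain ⟨k, G, hG⟩ := hadm
      exact ⟨k, G, hG, (h k G hG).symm⟩
  unfold alphagcm betagcm
  rw [this]
  exact ⟨csInf_singleton _, csSup_singleton _⟩

lemma one_le_delta {c m k : ℕ} (hc : 4 ≤ c) {G : SimpleGraph (Fin k)} (h : memHclass 3 c m G) :
    1 ≤ hypDelta G := by
  obtain ⟨hG, hg, hcirc, hm⟩ := h
  obtain ⟨a, w, hw, hl⟩ := circ_attained (G := G) (by omega)
  exact one_le_of_cycle hG w hw (by omega)

end MGH

/-- Theorem (calculo1m): values and bounds for `α(3,c,m)` for e-admissible triplets. -/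
theorem alphagcm_girth_three (c m : ℕ) (h3 : 3 ≤ c) (hcm : c ≤ m)
    (hadm : ∃ (k : ℕ) (G : SimpleGraph (Fin k)), memHclass 3 c m G) :
    (c = 3 → alphagcm 3 c m = 3 / 4 ∧ betagcm 3 c m = 3 / 4) ∧
    (4 ≤ c → m = c + 1 → alphagcm 3 c m = (c : ℝ) / 4 ∧ betagcm 3 c m = (c : ℝ) / 4) ∧
    (4 ≤ c → ∀ u : ℕ, 2 ≤ u → u < (c - 2) / 2 → m = c + u →
      1 ≤ alphagcm 3 c m ∧
      alphagcm 3 c m ≤ 5 / 4 + (⌈((c : ℝ) - 2) / (u : ℝ)⌉ : ℝ) / 4) ∧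
    (4 ≤ c → c + (c - 2) / 2 ≤ m → m < c * (c - 1) / 2 →
      1 ≤ alphagcm 3 c m ∧ alphagcm 3 c m ≤ 3 / 2) ∧
    (4 ≤ c → c * (c - 1) / 2 ≤ m → alphagcm 3 c m = 1) := by
  refine ⟨?_, ?_, ?_, ?_, ?_⟩
  · rintro rfl
    apply MGH.alpha_beta_eq hadm
    rintro k G ⟨hG, hg, hcirc, hm⟩
    apply le_antisymm
    · have := MGH.hypDelta_le_circ hG (by omega)
      rw [hcirc] at this
      exact_mod_cast this
    · obtain ⟨a, b, d, h1, h2, h3⟩ := MGH.triangle_of_girth hg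
      exact MGH.three_quarters hG h1 h2 h3
  · rintro hc rfl
    apply MGH.alpha_beta_eq hadm
    rintro k G ⟨hG, hg, hcirc, hm⟩
    apply le_antisymm
    · have := MGH.hypDelta_le_circ hG (by omega)
      rwa [hcirc] at this
    · exact MGH.chord_lower hG hc hg hcirc hm
  · rintro hc u hu1 hu2 rfl
    refine ⟨MGH.le_alpha hadm (fun k G hG => MGH.one_le_delta hc hG), ?_⟩
    have hu0 : (0 : ℝ) < u := by
      have : 0 < u := by omega
      exact_mod_cast this
    have hcr : (4 : ℝ) ≤ c := by exact_mod_cast hc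
    obtain ⟨r, hr⟩ : ∃ r : ℕ, ⌈((c : ℝ) - 2) / (u : ℝ)⌉ = (r : ℤ) :=
      Int.eq_ofNat_of_zero_le (Int.ceil_nonneg (by apply div_nonneg <;> linarith))
    have h1 : ((c : ℝ) - 2) / (u : ℝ) ≤ r := by
      have := Int.le_ceil (((c : ℝ) - 2) / (u : ℝ))
      rw [hr] at this
      exact_mod_cast this
    rw [div_le_iff₀ hu0] at h1
    have h2 : c ≤ r * u + 2 := by
      have : (c : ℝ) ≤ r * u + 2 := by linarith
      exact_mod_cast this
    have h3 : r * u ≤ 2 * ((r + 1) / 2) * u := Nat.mul_le_mul_right _ (by omega)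
    have h4 : (c - 2) / 2 ≤ u * ((r + 1) / 2) := by
      have : 2 * ((r + 1) / 2) * u = 2 * (u * ((r + 1) / 2)) := by ring
      omega
    obtain ⟨k, G, hG, hδ⟩ := MGH.exists_ladder c 0 u ((r + 1) / 2) hc (by omega) (by omega) h4
    refine MGH.alpha_le hG (hδ.trans ?_)
    rw [hr]
    have h5 : 2 * (((r + 1) / 2 : ℕ) : ℝ) ≤ r + 1 := by
      have : 2 * ((r + 1) / 2) ≤ r + 1 := by omega
      exact_mod_cast this
    push_cast at h5 ⊢
    linarith
  · intro hc h1 h2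
    refine ⟨MGH.le_alpha hadm (fun k G hG => MGH.one_le_delta hc hG), ?_⟩
    obtain ⟨k, G, hG, hδ⟩ := MGH.exists_ladder c (m - (c + (c - 2) / 2)) ((c - 2) / 2) 1 hc
      (by omega) le_rfl (by omega)
    rw [show c + (c - 2) / 2 + (m - (c + (c - 2) / 2)) = m by omega] at hG
    exact MGH.alpha_le hG (hδ.trans (by norm_num))
  · intro hc h1
    apply le_antisymm _ (MGH.le_alpha hadm (fun k G hG => MGH.one_le_delta hc hG))
    obtain ⟨k, G, hG, hδ⟩ := MGH.exists_complete c (m - c * (c - 1) / 2) hc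
    rw [Nat.add_sub_cancel' h1] at hG
    exact MGH.alpha_le hG hδ
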